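/- arXiv:0807.2058 — 4 statements merged into one kernel-verified Lean document; each statement's English description precedes it below -/
import Mathlib

section
/- Let h be a symmetric bilinear form on an n-dimensional real inner product space (V,g) and let t_k(h) denote its classical k-th Newton transformation, defined recursively by t_0(h) = g and t_k(h) = σ_k(h)·g − t_{k−1}(h)∘h, where (B∘h)(x,y) = Σ_i B(x,e_i)h(e_i,y) for an orthonormal basis (e_i). Then for every 1 ≤ k ≤ n−1 one has t_k(h) = σ_k(h)·g − c^{k−1}h^k/((k−1)!·k!). -/
/-!
Double forms on an `n`-dimensional real inner product space `(V, g)`, represented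
by their components with respect to a (fixed) orthonormal basis: a `(p,q)`-double
form is determined by its values on pairs of increasingly ordered tuples of
distinct basis vectors, i.e. by a function `Finset (Fin n) → Finset (Fin n) → ℝ`
(supported on pairs of sets of cardinalities `p` and `q`).
-/

open Finset

noncomputable section

abbrev DF (n : ℕ) := Finset (Fin n) → Finset (Fin n) → ℝ

namespace DF

variable {n : ℕ}

/-- The sign of the shuffle placing the increasing enumeration of `A` before that of
`B` and reordering increasingly. -/
def shuffleSign (A B : Finset (Fin n)) : ℝ :=
  (-1 : ℝ) ^ ∑ a ∈ A, (B.filter fun b => b < a).card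

/-- The exterior product of double forms (Kulkarni–Nomizu type product), in components. -/
def mul (ω θ : DF n) : DF n := fun S T =>
  ∑ A ∈ S.powerset, ∑ C ∈ T.powerset,
    shuffleSign A (S \ A) * shuffleSign C (T \ C) * ω A C * θ (S \ A) (T \ C)

/-- The `(0,0)`-double form `1`. -/
def one (n : ℕ) : DF n := fun S T => if S = ∅ ∧ T = ∅ then 1 else 0

/-- Powers `ω^k` of a double form with respect to the exterior product. -/
def pow (ω : DF n) : ℕ → DF n
  | 0 => one n
  | k + 1 => mul (pow ω k) ω

/-- The contraction `c ω`, obtained by summing, over an orthonormal basis, the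
insertion of the basis vector as first argument in both slots. -/
def contr (ω : DF n) : DF n := fun S T =>
  ∑ i : Fin n,
    if i ∈ S ∨ i ∈ T then 0
    else shuffleSign {i} S * shuffleSign {i} T * ω (insert i S) (insert i T)

/-- The iterated contraction `c^r`. -/
def contrN (r : ℕ) (ω : DF n) : DF n := contr^[r] ω

/-- The metric `g` as a `(1,1)`-double form (components in an orthonormal basis). -/
def gm (n : ℕ) : DF n := fun S T => if S = T ∧ S.card = 1 then 1 else 0

/-- The inner product of double forms induced by `g`. -/
def dinner (ω θ : DF n) : ℝ :=
  ∑ S : Finset (Fin n), ∑ T : Finset (Fin n), ω S T * θ S T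

/-- The scalar given by a `(0,0)`-double form. -/
def toScalar (ω : DF n) : ℝ := ω ∅ ∅

open scoped Classical in
/-- `σ_k` of a `(1,1)`-double form: the `k`-th elementary symmetric function of the
eigenvalues of the corresponding self-adjoint endomorphism (whose matrix in the
orthonormal basis is the matrix of components). -/
def sigma (k : ℕ) (ω : DF n) : ℝ :=
  if h : (Matrix.of fun i j => ω {i} {j} : Matrix (Fin n) (Fin n) ℝ).IsHermitian then
    ∑ s ∈ Finset.powersetCard k (Finset.univ : Finset (Fin n)), ∏ i ∈ s, h.eigenvalues i
  else 0

/-- `ω` is a `(p,p)`-double form: its components are supported in bidegree `(p,p)`. -/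
def IsDeg (p : ℕ) (ω : DF n) : Prop := ∀ S T, ω S T ≠ 0 → S.card = p ∧ T.card = p

/-- Symmetry of a double form: `ω(a;b) = ω(b;a)`. -/
def IsSymm (ω : DF n) : Prop := ∀ S T, ω S T = ω T S

/-- The first Bianchi identity for a `(p,p)`-double form (in components): the complete
antisymmetrization over the first `p+1` vector arguments vanishes. -/
def FirstBianchi (p : ℕ) (ω : DF n) : Prop :=
  ∀ U T : Finset (Fin n), U.card = p + 1 → T.card = p - 1 →
    ∑ i ∈ U,
      (if i ∈ T then 0
       else shuffleSign {i} (U.erase i) * shuffleSign {i} T * ω (U.erase i) (insert i T)) = 0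

end DF

section Geometry

variable {n : ℕ} {V : Type*} [NormedAddCommGroup V] [InnerProductSpace ℝ V]

/-- The components, in the orthonormal basis `e`, of a `(p,p)`-double form given as a
function of `p + p` vector arguments. -/
def ofForm (e : OrthonormalBasis (Fin n) ℝ V) (p : ℕ)
    (ω : (Fin p → V) → (Fin p → V) → ℝ) : DF n := fun S T =>
  if h : S.card = p ∧ T.card = p then
    ω (fun i => e ((S.orderIsoOfFin h.1 i : Fin n)))
      (fun i => e ((T.orderIsoOfFin h.2 i : Fin n)))
  else 0

/-- The components of a bilinear form, viewed as a `(1,1)`-double form. -/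
def ofBilin (e : OrthonormalBasis (Fin n) ℝ V) (b : V → V → ℝ) : DF n :=
  ofForm e 1 fun x y => b (x 0) (y 0)

/-- The components of a `(2,2)`-double form given as a function of four vectors. -/
def ofCurv (e : OrthonormalBasis (Fin n) ℝ V) (R : V → V → V → V → ℝ) : DF n :=
  ofForm e 2 fun x y => R (x 0) (x 1) (y 0) (y 1)

/-- Bilinearity of a real-valued function of two vector arguments. -/
def IsBilin (b : V → V → ℝ) : Prop :=
  (∀ (c : ℝ) (x x' y : V), b (c • x + x') y = c * b x y + b x' y) ∧
  (∀ (c : ℝ) (x y y' : V), b x (c • y + y') = c * b x y + b x y')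

/-- Symmetry of a bilinear form. -/
def IsSymmBilin (b : V → V → ℝ) : Prop := ∀ x y, b x y = b y x

/-- An algebraic curvature tensor: a multilinear form of four vectors, antisymmetric
in the first two arguments, symmetric under exchange of the two pairs, and satisfying
the first Bianchi identity. -/
structure IsCurv (R : V → V → V → V → ℝ) : Prop where
  linear : ∀ (c : ℝ) (x x' y z w : V), R (c • x + x') y z w = c * R x y z w + R x' y z w
  antisymm : ∀ x y z w, R x y z w = - R y x z w
  pair_symm : ∀ x y z w, R x y z w = R z w x y
  bianchi : ∀ x y z w, R x y z w + R y z x w + R z x y w = 0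

/-- Multilinearity of a real-valued function of `p` vector arguments. -/
def IsMultilinear (p : ℕ) (f : (Fin p → V) → ℝ) : Prop :=
  ∀ (x : Fin p → V) (i : Fin p) (c : ℝ) (u v : V),
    f (Function.update x i (c • u + v)) =
      c * f (Function.update x i u) + f (Function.update x i v)

/-- A function of `p` vector arguments is alternating. -/
def IsAlt (p : ℕ) (f : (Fin p → V) → ℝ) : Prop :=
  ∀ (x : Fin p → V) (i j : Fin p), i ≠ j → x i = x j → f x = 0

/-- A `(p,p)`-double form, as a function of `p + p` vector arguments:
multilinear and alternating in each of the two blocks of arguments. -/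
def IsDoubleForm (p : ℕ) (ω : (Fin p → V) → (Fin p → V) → ℝ) : Prop :=
  (∀ y, IsMultilinear p fun x => ω x y) ∧ (∀ y, IsAlt p fun x => ω x y) ∧
  (∀ x, IsMultilinear p fun y => ω x y) ∧ (∀ x, IsAlt p fun y => ω x y)

/-- Symmetry of a `(p,p)`-double form: `ω(x;y) = ω(y;x)`. -/
def IsSymmForm (p : ℕ) (ω : (Fin p → V) → (Fin p → V) → ℝ) : Prop := ∀ x y, ω x y = ω y x

/-- The first Bianchi identity for a `(p,p)`-double form of vector arguments:
the complete antisymmetrization over the first `p+1` vector arguments vanishes. -/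
def FirstBianchiForm (p : ℕ) (hp : 0 < p) (ω : (Fin p → V) → (Fin p → V) → ℝ) : Prop :=
  ∀ (z : Fin (p + 1) → V) (y : Fin p → V),
    ∑ σ : Equiv.Perm (Fin (p + 1)),
      ((Equiv.Perm.sign σ : ℤ) : ℝ) *
        ω (fun i => z (σ (Fin.castSucc i))) (Function.update y ⟨0, hp⟩ (z (σ (Fin.last p)))) = 0

/-- The scalar curvature `Scal = c²R` of a `(2,2)`-double form (in components). -/
def scalDF {n : ℕ} (Rd : DF n) : ℝ := DF.toScalar (DF.contrN 2 Rd)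

/-- The `2k`-th Gauss–Bonnet curvature `h_{2k} = c^{2k} R^k / (2k)!`. -/
def h2kDF {n : ℕ} (k : ℕ) (Rd : DF n) : ℝ :=
  DF.toScalar (DF.contrN (2 * k) (DF.pow Rd k)) / ((2 * k).factorial : ℝ)

/-- The second Gauss–Bonnet curvature `h₄ = c⁴ R² / 4!`. -/
def h4DF {n : ℕ} (Rd : DF n) : ℝ :=
  DF.toScalar (DF.contrN 4 (DF.pow Rd 2)) / (Nat.factorial 4 : ℝ)

end Geometry

end

open scoped RealInnerProductSpace

/-- The classical Newton transformations of a bilinear form `h`, defined recursively by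
`t₀(h) = g` and `t_k(h) = σ_k(h)·g − t_{k−1}(h)∘h`, where
`(B∘h)(x,y) = ∑ i, B(x, eᵢ) h(eᵢ, y)` for an orthonormal basis `(eᵢ)`. -/
noncomputable def newton {n : ℕ} {V : Type*} [NormedAddCommGroup V] [InnerProductSpace ℝ V]
    (e : OrthonormalBasis (Fin n) ℝ V) (h : V → V → ℝ) : ℕ → V → V → ℝ
  | 0 => fun x y => ⟪x, y⟫
  | k + 1 => fun x y =>
      DF.sigma (k + 1) (ofBilin e h) * ⟪x, y⟫ - ∑ i : Fin n, newton e h k x (e i) * h (e i) y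

namespace NT

variable {n : ℕ}

/-- Sum of bordered minors. -/
noncomputable def D (H : Matrix (Fin n) (Fin n) ℝ) (k : ℕ) : Matrix (Fin n) (Fin n) ℝ :=
  Matrix.of fun i j => ∑ w : Fin k → Fin n,
    (H.submatrix (Fin.cons i w : Fin (k + 1) → Fin n) (Fin.cons j w : Fin (k + 1) → Fin n)).det

/-- Sum of principal minors over tuples. -/
noncomputable def E (H : Matrix (Fin n) (Fin n) ℝ) (k : ℕ) : ℝ :=
  ∑ w : Fin k → Fin n, (H.submatrix w w).det

theorem E_zero (H : Matrix (Fin n) (Fin n) ℝ) : E H 0 = 1 := by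
  simp [E]

theorem D_zero (H : Matrix (Fin n) (Fin n) ℝ) : D H 0 = H := by
  ext i j
  simp [D]

theorem E_succ (H : Matrix (Fin n) (Fin n) ℝ) (k : ℕ) : E H (k + 1) = (D H k).trace := by
  simp only [E, D, Matrix.trace, Matrix.diag, Matrix.of_apply]
  rw [← (Fin.consEquiv (fun _ : Fin (k + 1) => Fin n)).sum_comp, Fintype.sum_prod_type]
  rfl

theorem term_rec (H : Matrix (Fin n) (Fin n) ℝ) (k : ℕ) (i j : Fin n) (w : Fin (k + 1) → Fin n) :
    (H.submatrix (Fin.cons i w : Fin (k + 2) → Fin n) (Fin.cons j w : Fin (k + 2) → Fin n)).det =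
      H i j * (H.submatrix w w).det - ∑ m : Fin (k + 1), H (w m) j *
        (H.submatrix (Fin.cons i (m.removeNth w) : Fin (k + 1) → Fin n)
          (Fin.cons (w m) (m.removeNth w) : Fin (k + 1) → Fin n)).det := by
  rw [Matrix.det_succ_column_zero, Fin.sum_univ_succ, sub_eq_add_neg, ← Finset.sum_neg_distrib]
  congr 1
  · simp [Matrix.submatrix_submatrix]
  · refine Finset.sum_congr rfl fun m _ => ?_
    have e1 : (Fin.cons (w m) (m.removeNth w) : Fin (k + 1) → Fin n) = w ∘ m.cycleRange.symm :=
      Fin.cons_removeNth_eq_comp_cycleRange_symm w m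
    have e2 : ((Fin.cons i w : Fin (k + 2) → Fin n) ∘ (m.succ.succAbove)) =
        (Fin.cons i (m.removeNth w) : Fin (k + 1) → Fin n) := by
      ext x
      cases x using Fin.cases <;> simp [Fin.removeNth_apply]
    have e3 : ((Fin.cons j w : Fin (k + 2) → Fin n) ∘ Fin.succ) = w := by
      ext x; simp
    rw [e1, Matrix.submatrix_submatrix, e2, e3]
    have := Matrix.det_permute' m.cycleRange.symm
      (H.submatrix (Fin.cons i (m.removeNth w) : Fin (k + 1) → Fin n) w)
    rw [Matrix.submatrix_submatrix] at this
    simp only [Function.comp_id] at this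
    rw [this]
    simp [Equiv.Perm.sign_symm, Fin.sign_cycleRange, pow_succ]
    ring

theorem D_succ (H : Matrix (Fin n) (Fin n) ℝ) (k : ℕ) :
    D H (k + 1) = E H (k + 1) • H - ((k : ℝ) + 1) • (D H k * H) := by
  ext i j
  simp only [Matrix.sub_apply, Matrix.smul_apply, smul_eq_mul, Matrix.mul_apply]
  conv_lhs => simp only [D, Matrix.of_apply]
  simp only [term_rec, Finset.sum_sub_distrib, E]
  congr 1
  · rw [Finset.sum_mul]
    exact Finset.sum_congr rfl fun _ _ => mul_comm _ _
  · rw [Finset.sum_comm]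
    have : ∀ m : Fin (k + 1), ∑ w : Fin (k + 1) → Fin n, H (w m) j *
        (H.submatrix (Fin.cons i (m.removeNth w) : Fin (k + 1) → Fin n)
          (Fin.cons (w m) (m.removeNth w) : Fin (k + 1) → Fin n)).det =
        ∑ a, D H k i a * H a j := by
      intro m
      rw [← (Fin.insertNthEquiv (fun _ : Fin (k + 1) => Fin n) m).sum_comp, Fintype.sum_prod_type]
      refine Finset.sum_congr rfl fun a _ => ?_
      simp only [Fin.insertNthEquiv_apply, Fin.insertNth_apply_same, D,
        Matrix.of_apply, Finset.sum_mul]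
      refine Finset.sum_congr rfl fun x _ => ?_
      have hx : m.removeNth ((Fin.insertNthEquiv (fun _ : Fin (k + 1) => Fin n) m) (a, x)) = x :=
        Fin.removeNth_insertNth (α := fun _ => Fin n) m a x
      rw [hx]
      exact mul_comm _ _
    rw [Finset.sum_congr rfl fun m _ => this m]
    simp

theorem conj_DE (U W M : Matrix (Fin n) (Fin n) ℝ) (hU : W * U = 1) (k : ℕ) :
    E (U * M * W) k = E M k ∧ D (U * M * W) k = U * D M k * W := by
  induction k with
  | zero => simp [E_zero, D_zero]
  | succ k ih =>
    have h1 : E (U * M * W) (k + 1) = E M (k + 1) := by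
      rw [E_succ, E_succ, ih.2, Matrix.trace_mul_comm, ← mul_assoc, hU, one_mul]
    refine ⟨h1, ?_⟩
    rw [D_succ, D_succ, h1, ih.2]
    have : U * D M k * W * (U * M * W) = U * (D M k * M) * W := by
      calc U * D M k * W * (U * M * W) = U * D M k * (W * U) * M * W := by noncomm_ring
        _ = _ := by rw [hU]; noncomm_ring
    rw [this]
    simp [mul_sub, sub_mul]

/-- elementary symmetric function -/
noncomputable def es (l : Fin n → ℝ) (k : ℕ) : ℝ :=
  ∑ s ∈ Finset.powersetCard k (Finset.univ : Finset (Fin n)), ∏ i ∈ s, l i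

/-- part of it containing `i` -/
noncomputable def ea (l : Fin n → ℝ) (k : ℕ) (i : Fin n) : ℝ :=
  ∑ s ∈ (Finset.powersetCard k (Finset.univ : Finset (Fin n))).filter (fun s => i ∈ s), ∏ i ∈ s, l i

theorem sum_ea (l : Fin n → ℝ) (k : ℕ) : ∑ i, ea l k i = k * es l k := by
  simp only [ea, es, Finset.sum_filter]
  rw [Finset.sum_comm, Finset.mul_sum]
  refine Finset.sum_congr rfl fun s hs => ?_
  rw [Finset.mem_powersetCard] at hs
  simp [hs.2]

theorem ea_succ (l : Fin n → ℝ) (k : ℕ) (i : Fin n) :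
    ea l (k + 1) i = l i * (es l k - ea l k i) := by
  have : es l k - ea l k i =
    ∑ s ∈ (Finset.powersetCard k (Finset.univ : Finset (Fin n))).filter (fun s => i ∉ s),
      ∏ i ∈ s, l i := by
    rw [es, ea, ← Finset.sum_filter_add_sum_filter_not _ (fun s => i ∈ s)]
    ring
  rw [this, ea, Finset.mul_sum]
  refine Finset.sum_bij' (fun s _ => s.erase i) (fun s _ => insert i s) ?_ ?_ ?_ ?_ ?_
  · intro s hs
    simp only [Finset.mem_filter, Finset.mem_powersetCard] at hs ⊢
    simp [Finset.card_erase_of_mem hs.2, hs.1.2]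
  · intro s hs
    simp only [Finset.mem_filter, Finset.mem_powersetCard] at hs ⊢
    simp [Finset.card_insert_of_notMem hs.2, hs.1.2]
  · intro s hs
    simp only [Finset.mem_filter] at hs
    exact Finset.insert_erase hs.2
  · intro s hs
    simp only [Finset.mem_filter] at hs
    exact Finset.erase_insert hs.2
  · intro s hs
    simp only [Finset.mem_filter] at hs
    exact (Finset.mul_prod_erase s l hs.2).symm

theorem diag_DE (l : Fin n → ℝ) (k : ℕ) :
    E (Matrix.diagonal l) k = k.factorial * es l k ∧
      D (Matrix.diagonal l) k = Matrix.diagonal fun i => k.factorial * ea l (k + 1) i := by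
  induction k with
  | zero =>
    refine ⟨by simp [E_zero, es], ?_⟩
    rw [D_zero]
    congr 1
    ext i
    rw [ea_succ]
    have : ea l 0 i = 0 := by
      simp [ea, Finset.filter_singleton]
    simp [this, es]
  | succ k ih =>
    have h1 : E (Matrix.diagonal l) (k + 1) = (k + 1).factorial * es l (k + 1) := by
      rw [E_succ, ih.2, Matrix.trace_diagonal, ← Finset.mul_sum, sum_ea, Nat.factorial_succ]
      push_cast
      ring
    refine ⟨h1, ?_⟩
    rw [D_succ, ih.2, h1, Matrix.diagonal_mul_diagonal, ← Matrix.diagonal_smul,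
      ← Matrix.diagonal_smul, Matrix.diagonal_sub]
    congr 1
    ext i
    simp only [Pi.smul_apply, smul_eq_mul]
    rw [ea_succ l (k + 1), Nat.factorial_succ]
    push_cast
    ring

theorem E_eq (H : Matrix (Fin n) (Fin n) ℝ) (hH : H.IsHermitian) (k : ℕ) :
    E H k = k.factorial * es hH.eigenvalues k := by
  conv_lhs => rw [hH.spectral_theorem, Unitary.conjStarAlgAut_apply]
  rw [(conj_DE _ _ _ (by simp) k).1]
  exact (diag_DE _ k).1

/-- The double form with values `F` on increasing tuples. -/
def toDF (p : ℕ) (F : (Fin p → Fin n) → (Fin p → Fin n) → ℝ) : DF n := fun S T =>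
  if h : S.card = p ∧ T.card = p then F (S.orderEmbOfFin h.1) (T.orderEmbOfFin h.2) else 0

/-- Alternating in both groups of arguments. -/
def Alt (p : ℕ) (F : (Fin p → Fin n) → (Fin p → Fin n) → ℝ) : Prop :=
  (∀ f g (σ : Equiv.Perm (Fin p)), F (f ∘ σ) g = ((Equiv.Perm.sign σ : ℤ) : ℝ) * F f g) ∧
  (∀ f g (σ : Equiv.Perm (Fin p)), F f (g ∘ σ) = ((Equiv.Perm.sign σ : ℤ) : ℝ) * F f g)

theorem alt_zero {p : ℕ} (G : (Fin p → Fin n) → ℝ)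
    (hG : ∀ f (σ : Equiv.Perm (Fin p)), G (f ∘ σ) = ((Equiv.Perm.sign σ : ℤ) : ℝ) * G f)
    (f : Fin p → Fin n) (a b : Fin p) (hab : a ≠ b) (hf : f a = f b) : G f = 0 := by
  have h1 : f ∘ Equiv.swap a b = f := by
    ext x
    simp only [Function.comp_apply, Equiv.swap_apply_def]
    split_ifs with h1 h2
    · rw [h1, hf]
    · rw [h2, hf]
    · rfl
  have := hG f (Equiv.swap a b)
  rw [h1, Equiv.Perm.sign_swap hab] at this
  push_cast at this
  linarith

theorem emb_erase {p : ℕ} (U : Finset (Fin n)) (hU : U.card = p + 1) (m : Fin (p + 1))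
    (h' : (U.erase (U.orderEmbOfFin hU m)).card = p) :
    ((U.erase (U.orderEmbOfFin hU m)).orderEmbOfFin h' : Fin p → Fin n) =
      U.orderEmbOfFin hU ∘ m.succAbove := by
  symm
  apply Finset.orderEmbOfFin_unique h'
  · intro x
    simp only [Function.comp_apply, Finset.mem_erase]
    refine ⟨?_, Finset.orderEmbOfFin_mem _ _ _⟩
    intro h
    exact Fin.succAbove_ne m x ((U.orderEmbOfFin hU).injective h)
  · exact (U.orderEmbOfFin hU).strictMono.comp (Fin.strictMono_succAbove m)

theorem card_lt {p : ℕ} (U : Finset (Fin n)) (hU : U.card = p + 1) (m : Fin (p + 1)) :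
    (U.filter (fun b => b < U.orderEmbOfFin hU m)).card = m := by
  have : U.filter (fun b => b < U.orderEmbOfFin hU m) =
      (Finset.Iio m).map (U.orderEmbOfFin hU).toEmbedding := by
    ext x
    simp only [Finset.mem_filter, Finset.mem_map, Finset.mem_Iio]
    constructor
    · rintro ⟨hx, hlt⟩
      have : x ∈ Set.range (U.orderEmbOfFin hU) := by
        rw [Finset.range_orderEmbOfFin]; exact hx
      obtain ⟨y, rfl⟩ := this
      exact ⟨y, (U.orderEmbOfFin hU).lt_iff_lt.1 hlt, rfl⟩
    · rintro ⟨y, hy, rfl⟩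
      exact ⟨Finset.orderEmbOfFin_mem _ _ _, (U.orderEmbOfFin hU).lt_iff_lt.2 hy⟩
  rw [this, Finset.card_map, Fin.card_Iio]

theorem card_gt {p : ℕ} (U : Finset (Fin n)) (hU : U.card = p + 1) (m : Fin (p + 1)) :
    (U.filter (fun b => U.orderEmbOfFin hU m < b)).card = p - m := by
  have : U.filter (fun b => U.orderEmbOfFin hU m < b) =
      (Finset.Ioi m).map (U.orderEmbOfFin hU).toEmbedding := by
    ext x
    simp only [Finset.mem_filter, Finset.mem_map, Finset.mem_Ioi]
    constructor
    · rintro ⟨hx, hlt⟩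
      have : x ∈ Set.range (U.orderEmbOfFin hU) := by
        rw [Finset.range_orderEmbOfFin]; exact hx
      obtain ⟨y, rfl⟩ := this
      exact ⟨y, (U.orderEmbOfFin hU).lt_iff_lt.1 hlt, rfl⟩
    · rintro ⟨y, hy, rfl⟩
      exact ⟨Finset.orderEmbOfFin_mem _ _ _, (U.orderEmbOfFin hU).lt_iff_lt.2 hy⟩
  rw [this, Finset.card_map, Fin.card_Ioi]
  omega

theorem cons_sign {p : ℕ} (S : Finset (Fin n)) (i : Fin n) (hi : i ∉ S) (hS : S.card = p)
    (hU : (insert i S).card = p + 1) :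
    ∃ σ : Equiv.Perm (Fin (p + 1)),
      (Fin.cons i (S.orderEmbOfFin hS) : Fin (p + 1) → Fin n) = (insert i S).orderEmbOfFin hU ∘ σ ∧
      ((Equiv.Perm.sign σ : ℤ) : ℝ) = DF.shuffleSign {i} S := by
  have : i ∈ Set.range ((insert i S).orderEmbOfFin hU) := by
    rw [Finset.range_orderEmbOfFin]; simp
  obtain ⟨m, hm⟩ := this
  have hE : (insert i S).erase ((insert i S).orderEmbOfFin hU m) = S := by
    rw [hm, Finset.erase_insert hi]
  have h1 := emb_erase (insert i S) hU m (by rw [hE, hS])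
  have h2 : (S.orderEmbOfFin hS : Fin p → Fin n) = (insert i S).orderEmbOfFin hU ∘ m.succAbove := by
    rw [← h1]
    congr 2
    exact hE.symm
  refine ⟨m.cycleRange.symm, ?_, ?_⟩
  · rw [← Fin.cons_removeNth_eq_comp_cycleRange_symm, h2, hm]
    rfl
  · have h3 := card_lt (insert i S) hU m
    rw [hm, Finset.filter_insert, if_neg (lt_irrefl i)] at h3
    simp [DF.shuffleSign, Equiv.Perm.sign_symm, Fin.sign_cycleRange, h3]

/-- contraction on tuples -/
noncomputable def Ctr {p : ℕ} (F : (Fin (p + 1) → Fin n) → (Fin (p + 1) → Fin n) → ℝ) :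
    (Fin p → Fin n) → (Fin p → Fin n) → ℝ :=
  fun f g => ∑ i, F (Fin.cons i f) (Fin.cons i g)

theorem cons_noninj {p : ℕ} (S : Finset (Fin n)) (i : Fin n) (hi : i ∈ S) (hS : S.card = p) :
    ∃ a b : Fin (p + 1), a ≠ b ∧ (Fin.cons i (S.orderEmbOfFin hS) : Fin (p + 1) → Fin n) a =
      (Fin.cons i (S.orderEmbOfFin hS) : Fin (p + 1) → Fin n) b := by
  have : i ∈ Set.range (S.orderEmbOfFin hS) := by
    rw [Finset.range_orderEmbOfFin]; exact hi
  obtain ⟨m, hm⟩ := this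
  exact ⟨0, m.succ, (Fin.succ_ne_zero m).symm, by simp [hm]⟩

theorem contr_toDF {p : ℕ} (F : (Fin (p + 1) → Fin n) → (Fin (p + 1) → Fin n) → ℝ)
    (hF : Alt (p + 1) F) : DF.contr (toDF (p + 1) F) = toDF p (Ctr F) := by
  funext S T
  by_cases h : S.card = p ∧ T.card = p
  · obtain ⟨hS, hT⟩ := h
    simp only [DF.contr, toDF, dif_pos (And.intro hS hT), Ctr]
    refine Finset.sum_congr rfl fun i _ => ?_
    by_cases hiS : i ∈ S
    · rw [if_pos (Or.inl hiS)]
      obtain ⟨a, b, hab, he⟩ := cons_noninj S i hiS hS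
      exact (alt_zero (fun f => F f _) (fun f σ => hF.1 f _ σ) _ a b hab he).symm
    by_cases hiT : i ∈ T
    · rw [if_pos (Or.inr hiT)]
      obtain ⟨a, b, hab, he⟩ := cons_noninj T i hiT hT
      exact (alt_zero (fun f => F _ f) (fun f σ => hF.2 _ f σ) _ a b hab he).symm
    have hS' : (insert i S).card = p + 1 := by rw [Finset.card_insert_of_notMem hiS, hS]
    have hT' : (insert i T).card = p + 1 := by rw [Finset.card_insert_of_notMem hiT, hT]
    rw [if_neg (by tauto), dif_pos ⟨hS', hT'⟩]
    obtain ⟨σ, h1, h2⟩ := cons_sign S i hiS hS hS'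
    obtain ⟨τ, h3, h4⟩ := cons_sign T i hiT hT hT'
    rw [h1, h3, hF.1, hF.2, h2, h4]
    ring
  · simp only [DF.contr, toDF, dif_neg h]
    refine Finset.sum_eq_zero fun i _ => ?_
    split_ifs with h1 h2
    · rfl
    · exfalso
      push Not at h1
      rw [Finset.card_insert_of_notMem h1.1, Finset.card_insert_of_notMem h1.2] at h2
      omega
    · simp

theorem cons_comp_perm {p : ℕ} (i : Fin n) (f : Fin p → Fin n) (σ : Equiv.Perm (Fin p)) :
    (Fin.cons i (f ∘ σ) : Fin (p + 1) → Fin n) =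
      (Fin.cons i f : Fin (p + 1) → Fin n) ∘ (Equiv.Perm.decomposeFin.symm (0, σ)) := by
  ext x
  cases x using Fin.cases <;> simp

theorem alt_Ctr {p : ℕ} (F : (Fin (p + 1) → Fin n) → (Fin (p + 1) → Fin n) → ℝ)
    (hF : Alt (p + 1) F) : Alt p (Ctr F) := by
  constructor
  · intro f g σ
    simp only [Ctr, cons_comp_perm, hF.1, Finset.mul_sum]
    simp
  · intro f g σ
    simp only [Ctr, cons_comp_perm, hF.2, Finset.mul_sum]
    simp

theorem alt_snoc {p : ℕ} (F : (Fin (p + 1) → Fin n) → (Fin (p + 1) → Fin n) → ℝ)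
    (hF : Alt (p + 1) F) (i : Fin n) (f g : Fin p → Fin n) :
    F (Fin.snoc f i) (Fin.snoc g i) = F (Fin.cons i f) (Fin.cons i g) := by
  have e : ∀ f : Fin p → Fin n, (Fin.snoc f i : Fin (p + 1) → Fin n) =
      (Fin.cons i f : Fin (p + 1) → Fin n) ∘ (finRotate (p + 1)) := fun f =>
    Fin.snoc_eq_cons_rotate f i
  rw [e, e, hF.1, hF.2, ← mul_assoc, ← Int.cast_mul, ← Units.val_mul, Int.units_mul_self]
  simp

theorem contrN_toDF {p : ℕ} (r : ℕ) (F : (Fin (p + r) → Fin n) → (Fin (p + r) → Fin n) → ℝ)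
    (hF : Alt (p + r) F) : DF.contrN r (toDF (p + r) F) =
      toDF p (fun f g => ∑ w : Fin r → Fin n, F (Fin.append f w) (Fin.append g w)) := by
  induction r with
  | zero =>
    have : (fun f g => ∑ w : Fin 0 → Fin n, F (Fin.append f w) (Fin.append g w)) = F := by
      funext f g
      rw [Fintype.sum_unique]
      congr 1 <;> · rw [Subsingleton.elim default Fin.elim0, Fin.append_elim0]; rfl
    rw [this]
    rfl
  | succ r ih =>
    have h1 : DF.contrN (r + 1) (toDF (p + (r + 1)) F) = DF.contrN r (toDF (p + r) (Ctr F)) := by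
      rw [← contr_toDF (p := p + r) F hF]
      rfl
    rw [h1, ih _ (alt_Ctr (p := p + r) F hF)]
    congr 1
    funext f g
    rw [← (Fin.snocEquiv (fun _ : Fin (r + 1) => Fin n)).sum_comp, Fintype.sum_prod_type,
      Finset.sum_comm]
    refine Finset.sum_congr rfl fun w _ => ?_
    refine Finset.sum_congr rfl fun i _ => ?_
    have := alt_snoc (p := p + r) F hF i (Fin.append f w) (Fin.append g w)
    rw [← this, ← Fin.append_snoc, ← Fin.append_snoc]
    rfl

/-- determinant form -/
noncomputable def Fd (H : Matrix (Fin n) (Fin n) ℝ) (k : ℕ) (f g : Fin k → Fin n) : ℝ :=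
  k.factorial * (H.submatrix f g).det

theorem alt_Fd (H : Matrix (Fin n) (Fin n) ℝ) (k : ℕ) : Alt k (Fd H k) := by
  constructor
  · intro f g σ
    have := Matrix.det_permute σ (H.submatrix f g)
    rw [Matrix.submatrix_submatrix] at this
    simp only [Function.comp_id] at this
    rw [Fd, Fd, this]
    ring
  · intro f g σ
    have := Matrix.det_permute' σ (H.submatrix f g)
    rw [Matrix.submatrix_submatrix] at this
    simp only [Function.comp_id] at this
    rw [Fd, Fd, this]
    ring

theorem sum_pow {k : ℕ} (S : Finset (Fin n)) (hS : S.card = k + 1) (X : Finset (Fin n) → ℝ)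
    (hX : ∀ A, A ⊆ S → A.card ≠ k → X A = 0) :
    ∑ A ∈ S.powerset, X A = ∑ m : Fin (k + 1), X (S.erase (S.orderEmbOfFin hS m)) := by
  rw [← Finset.sum_image (s := Finset.univ) (g := fun m => S.erase (S.orderEmbOfFin hS m))]
  · symm
    apply Finset.sum_subset
    · intro A hA
      simp only [Finset.mem_image] at hA
      obtain ⟨m, -, rfl⟩ := hA
      exact Finset.mem_powerset.2 (Finset.erase_subset _ _)
    · intro A hA hA'
      rw [Finset.mem_powerset] at hA
      apply hX A hA
      intro hc
      apply hA'
      have h1 : (S \ A).card = 1 := by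
        rw [Finset.card_sdiff_of_subset hA]; omega
      obtain ⟨a, ha⟩ := Finset.card_eq_one.1 h1
      have haS : a ∈ S := by
        have : a ∈ S \ A := by rw [ha]; simp
        exact (Finset.mem_sdiff.1 this).1
      have : a ∈ Set.range (S.orderEmbOfFin hS) := by
        rw [Finset.range_orderEmbOfFin]; exact haS
      obtain ⟨m, rfl⟩ := this
      rw [Finset.mem_image]
      refine ⟨m, Finset.mem_univ _, ?_⟩
      rw [← Finset.sdiff_singleton_eq_erase, ← ha, Finset.sdiff_sdiff_eq_self hA]
  · intro a _ b _ hab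
    exact (S.orderEmbOfFin hS).injective
      (Finset.erase_injOn S (Finset.orderEmbOfFin_mem S hS a) (Finset.orderEmbOfFin_mem S hS b) hab)

theorem sign_erase {k : ℕ} (S : Finset (Fin n)) (hS : S.card = k + 1) (m : Fin (k + 1)) :
    DF.shuffleSign (S.erase (S.orderEmbOfFin hS m)) {S.orderEmbOfFin hS m} = (-1) ^ k * (-1) ^ (m : ℕ) := by
  have h1 : ∑ a ∈ S.erase (S.orderEmbOfFin hS m),
      (({S.orderEmbOfFin hS m} : Finset (Fin n)).filter (fun b => b < a)).card = k - m := by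
    rw [← card_gt S hS m, Finset.card_filter,
      ← Finset.sum_erase S (a := S.orderEmbOfFin hS m)
        (f := fun i => if S.orderEmbOfFin hS m < i then 1 else 0) (by simp)]
    refine Finset.sum_congr rfl fun a _ => ?_
    rw [Finset.filter_singleton]
    split_ifs <;> simp
  rw [DF.shuffleSign, h1]
  have h2 : (-1 : ℝ) ^ k = (-1) ^ (k - (m : ℕ)) * (-1) ^ (m : ℕ) := by
    rw [← pow_add]
    congr 1
    omega
  rw [h2, mul_assoc, ← mul_pow]
  simp

theorem mul_toDF (H : Matrix (Fin n) (Fin n) ℝ) (k : ℕ) :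
    DF.mul (toDF k (Fd H k)) (toDF 1 (fun f g => H (f 0) (g 0))) = toDF (k + 1) (Fd H (k + 1)) := by
  funext S T
  by_cases h : S.card = k + 1 ∧ T.card = k + 1
  · obtain ⟨hS, hT⟩ := h
    rw [DF.mul, sum_pow S hS]
    · have : ∀ m : Fin (k + 1), ∑ C ∈ T.powerset,
        DF.shuffleSign (S.erase (S.orderEmbOfFin hS m)) (S \ S.erase (S.orderEmbOfFin hS m)) *
          DF.shuffleSign C (T \ C) * toDF k (Fd H k) (S.erase (S.orderEmbOfFin hS m)) C *
          toDF 1 (fun f g => H (f 0) (g 0)) (S \ S.erase (S.orderEmbOfFin hS m)) (T \ C) =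
          k.factorial * (H.submatrix (S.orderEmbOfFin hS) (T.orderEmbOfFin hT)).det := by
        intro m
        rw [sum_pow T hT, Matrix.det_succ_row _ m, Finset.mul_sum]
        · refine Finset.sum_congr rfl fun l _ => ?_
          have eS : S \ S.erase (S.orderEmbOfFin hS m) = {S.orderEmbOfFin hS m} :=
            Finset.sdiff_erase_self (Finset.orderEmbOfFin_mem S hS m)
          have eT : T \ T.erase (T.orderEmbOfFin hT l) = {T.orderEmbOfFin hT l} :=
            Finset.sdiff_erase_self (Finset.orderEmbOfFin_mem T hT l)
          have cS : (S.erase (S.orderEmbOfFin hS m)).card = k := by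
            rw [Finset.card_erase_of_mem (Finset.orderEmbOfFin_mem S hS m), hS]; rfl
          have cT : (T.erase (T.orderEmbOfFin hT l)).card = k := by
            rw [Finset.card_erase_of_mem (Finset.orderEmbOfFin_mem T hT l), hT]; rfl
          rw [eS, eT, sign_erase, sign_erase]
          simp only [toDF]
          rw [dif_pos ⟨cS, cT⟩, dif_pos ⟨Finset.card_singleton _, Finset.card_singleton _⟩,
            emb_erase, emb_erase]
          simp only [Finset.orderEmbOfFin_singleton, Fd, Matrix.submatrix_submatrix,
            Matrix.submatrix_apply]
          have : ((-1 : ℝ)) ^ k * (-1) ^ k = 1 := by rw [← mul_pow]; simp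
          rw [pow_add]
          linear_combination ((-1) ^ (m : ℕ) * (-1) ^ (l : ℕ) * (k.factorial : ℝ) *
            (H.submatrix (S.orderEmbOfFin hS ∘ m.succAbove) (T.orderEmbOfFin hT ∘ l.succAbove)).det
            * H (S.orderEmbOfFin hS m) (T.orderEmbOfFin hT l)) * this
        · intro C _ hc
          simp [toDF, hc]
      rw [Finset.sum_congr rfl fun m _ => this m]
      simp only [toDF, dif_pos (And.intro hS hT), Fd, Nat.factorial_succ]
      simp
      ring
    · intro A _ hc
      simp [toDF, hc]
  · simp only [DF.mul]
    rw [toDF, dif_neg h]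
    refine Finset.sum_eq_zero fun A hA => Finset.sum_eq_zero fun C hC => ?_
    rw [Finset.mem_powerset] at hA hC
    simp only [toDF]
    split_ifs with h1 h2
    · exfalso
      have a1 := Finset.card_sdiff_add_card_eq_card hA
      have a2 := Finset.card_sdiff_add_card_eq_card hC
      omega
    all_goals simp

theorem pow_toDF (H : Matrix (Fin n) (Fin n) ℝ) (k : ℕ) :
    DF.pow (toDF 1 (fun f g => H (f 0) (g 0))) k = toDF k (Fd H k) := by
  induction k with
  | zero =>
    funext S T
    simp [DF.pow, DF.one, toDF, Fd]
  | succ k ih => rw [DF.pow, ih, mul_toDF]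

theorem contr_pow (H : Matrix (Fin n) (Fin n) ℝ) (r : ℕ) :
    DF.contrN r (DF.pow (toDF 1 (fun f g => H (f 0) (g 0))) (r + 1)) =
      toDF 1 (fun f g => (r + 1).factorial * D H r (f 0) (g 0)) := by
  rw [add_comm r 1, pow_toDF, contrN_toDF _ _ (alt_Fd _ _)]
  congr 1
  funext f g
  simp only [Fd, D, Matrix.of_apply, Finset.mul_sum]
  refine Finset.sum_congr rfl fun w _ => ?_
  rw [Fin.append_left_eq_cons, Fin.append_left_eq_cons]
  congr 1
  have := Matrix.det_submatrix_equiv_self (finCongr (Nat.add_comm 1 r))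
    (H.submatrix (Fin.cons (f 0) w : Fin (r + 1) → Fin n) (Fin.cons (g 0) w : Fin (r + 1) → Fin n))
  rw [← this]
  rfl

theorem toDF_one (b : Fin n → Fin n → ℝ) (i j : Fin n) :
    toDF 1 (fun f g => b (f 0) (g 0)) {i} {j} = b i j := by
  simp [toDF]

theorem ofBilin_eq {V : Type*} [NormedAddCommGroup V] [InnerProductSpace ℝ V]
    (e : OrthonormalBasis (Fin n) ℝ V) (b : V → V → ℝ) :
    ofBilin e b = toDF 1 (fun f g => b (e (f 0)) (e (g 0))) := rfl

theorem newton_eq {V : Type*} [NormedAddCommGroup V] [InnerProductSpace ℝ V]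
    (e : OrthonormalBasis (Fin n) ℝ V) (h : V → V → ℝ) (H : Matrix (Fin n) (Fin n) ℝ)
    (hH : ∀ i j, h (e i) (e j) = H i j)
    (hs : ∀ k, E H k = k.factorial * DF.sigma k (ofBilin e h)) (k : ℕ) (i j : Fin n) :
    newton e h (k + 1) (e i) (e j) = DF.sigma (k + 1) (ofBilin e h) * (if i = j then 1 else 0) -
      (k.factorial : ℝ)⁻¹ * D H k i j := by
  have hin : ∀ i j, ⟪e i, e j⟫ = (if i = j then (1 : ℝ) else 0) :=
    orthonormal_iff_ite.1 e.orthonormal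
  induction k generalizing i j with
  | zero =>
    rw [newton]
    beta_reduce
    rw [hin]
    simp [newton, hin, hH, D_zero]
  | succ k ih =>
    rw [newton]
    beta_reduce
    rw [hin]
    congr 1
    simp only [ih, hH, sub_mul, Finset.sum_sub_distrib]
    rw [D_succ, hs (k + 1)]
    simp only [Matrix.sub_apply, Matrix.smul_apply, smul_eq_mul, Matrix.mul_apply]
    simp only [mul_assoc, ← Finset.mul_sum]
    have h1 : ((k + 1).factorial : ℝ) ≠ 0 := by positivity
    have h2 : (k.factorial : ℝ) ≠ 0 := by positivity
    have h3 : ((k + 1).factorial : ℝ) = (k + 1) * k.factorial := by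
      rw [Nat.factorial_succ]; push_cast; ring
    have h4 : (k : ℝ) + 1 ≠ 0 := by positivity
    rw [h3]
    simp
    field_simp

end NT

/-- For every symmetric bilinear form `h` on an `n`-dimensional real
inner product space and every `1 ≤ k ≤ n−1`,
`t_k(h) = σ_k(h)·g − c^(k−1) h^k / ((k−1)!·k!)`. -/
theorem stmt1_newton_transformation_formula
    (n k : ℕ) (hk1 : 1 ≤ k) (hk2 : k ≤ n - 1)
    (V : Type*) [NormedAddCommGroup V] [InnerProductSpace ℝ V]
    (hV : Module.finrank ℝ V = n)
    (e : OrthonormalBasis (Fin n) ℝ V)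
    (h : V → V → ℝ) (hbil : IsBilin h) (hsymm : IsSymmBilin h) :
    ofBilin e (newton e h k) =
      DF.sigma k (ofBilin e h) • DF.gm n -
        (((k - 1).factorial * k.factorial : ℕ) : ℝ)⁻¹ •
          DF.contrN (k - 1) (DF.pow (ofBilin e h) k) := by
  obtain ⟨r, rfl⟩ : ∃ r, k = r + 1 := ⟨k - 1, by omega⟩
  set H : Matrix (Fin n) (Fin n) ℝ := Matrix.of fun i j => h (e i) (e j) with hHdef
  have hO : ofBilin e h = NT.toDF 1 (fun f g => H (f 0) (g 0)) := rfl
  have hM : (Matrix.of fun i j => (ofBilin e h) {i} {j} : Matrix (Fin n) (Fin n) ℝ) = H := by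
    ext i j
    rw [hO]
    exact NT.toDF_one H i j
  have hherm : H.IsHermitian := by
    ext i j
    simp [hHdef, hsymm (e j) (e i)]
  have hs : ∀ k, NT.E H k = k.factorial * DF.sigma k (ofBilin e h) := by
    intro k
    have : DF.sigma k (ofBilin e h) = NT.es hherm.eigenvalues k := by
      unfold DF.sigma
      simp only [hM]
      rw [dif_pos hherm]
      rfl
    rw [this, NT.E_eq H hherm]
  have hN := NT.newton_eq e h H (fun _ _ => rfl) hs r
  rw [show r + 1 - 1 = r from rfl]
  conv_rhs => rw [hO, NT.contr_pow, ← hO]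
  funext S T
  rw [NT.ofBilin_eq]
  simp only [Pi.sub_apply, Pi.smul_apply, smul_eq_mul]
  by_cases hc : S.card = 1 ∧ T.card = 1
  · obtain ⟨i, rfl⟩ := Finset.card_eq_one.1 hc.1
    obtain ⟨j, rfl⟩ := Finset.card_eq_one.1 hc.2
    rw [NT.toDF_one (fun i j => newton e h (r + 1) (e i) (e j)),
      NT.toDF_one (fun i j => ((r + 1).factorial : ℝ) * NT.D H r i j), hN]
    have h1 : ((r + 1).factorial : ℝ) ≠ 0 := by positivity
    have h2 : (r.factorial : ℝ) ≠ 0 := by positivity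
    congr 1
    · simp [DF.gm]
    · push_cast
      field_simp
  · simp only [NT.toDF, dif_neg hc, DF.gm]
    rw [if_neg]
    · simp
    · rintro ⟨rfl, h1⟩
      exact hc ⟨h1, h1⟩
end

section
/- Let A be a symmetric bilinear form on an n-dimensional real inner product space (V,g) and let R = gA be the (2,2)-double form product of the metric with A (the algebraic curvature tensor of a conformally flat structure). Then for every integer k with 0 ≤ 2k ≤ n, the 2k-th Gauss–Bonnet curvature of R satisfies h_{2k} = c^{2k}(gA)^k/(2k)! = ((n−k)!·k!/(n−2k)!)·σ_k(A). -/
/-!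
Double forms on an `n`-dimensional real inner product space `(V, g)`, represented
by their components with respect to a (fixed) orthonormal basis: a `(p,q)`-double
form is determined by its values on pairs of increasingly ordered tuples of
distinct basis vectors, i.e. by a function `Finset (Fin n) → Finset (Fin n) → ℝ`
(supported on pairs of sets of cardinalities `p` and `q`).
-/

open Finset

namespace DF

variable {n : ℕ}

lemma shuffleSign_sq (A B : Finset (Fin n)) : shuffleSign A B * shuffleSign A B = 1 := by
  unfold shuffleSign
  rw [← pow_add, ← two_mul, pow_mul]; simp

lemma shuffleSign_union_right (A B C : Finset (Fin n)) (h : Disjoint B C) :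
    shuffleSign A (B ∪ C) = shuffleSign A B * shuffleSign A C := by
  unfold shuffleSign
  rw [← pow_add, ← Finset.sum_add_distrib]
  congr 1
  refine Finset.sum_congr rfl fun a _ => ?_
  rw [Finset.filter_union, Finset.card_union_of_disjoint]
  exact Finset.disjoint_filter_filter h

lemma shuffleSign_union_left (A B C : Finset (Fin n)) (h : Disjoint A B) :
    shuffleSign (A ∪ B) C = shuffleSign A C * shuffleSign B C := by
  unfold shuffleSign
  rw [← pow_add, Finset.sum_union h]

lemma shuffleSign_comm (A B : Finset (Fin n)) (h : Disjoint A B) :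
    shuffleSign A B = (-1) ^ (A.card * B.card) * shuffleSign B A := by
  have key : ∑ a ∈ A, (B.filter fun b => b < a).card + ∑ b ∈ B, (A.filter fun a => a < b).card
      = A.card * B.card := by
    have h2 : ∑ b ∈ B, (A.filter fun a => a < b).card
        = ∑ a ∈ A, (B.filter fun b => a < b).card := by
      simp only [Finset.card_filter]
      exact Finset.sum_comm
    rw [h2, ← Finset.sum_add_distrib, ← smul_eq_mul, ← Finset.sum_const]
    refine Finset.sum_congr rfl fun a ha => ?_
    rw [← Finset.card_filter_add_card_filter_not (s := B) (p := fun b => b < a)]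
    congr 2
    ext b
    simp only [Finset.mem_filter, not_lt]
    refine and_congr_right fun hb => ⟨le_of_lt, fun hle => lt_of_le_of_ne hle ?_⟩
    rintro rfl
    exact Finset.disjoint_left.1 h ha hb
  rw [← key, pow_add, mul_assoc]
  change shuffleSign A B = shuffleSign A B * (shuffleSign B A * shuffleSign B A)
  rw [shuffleSign_sq, mul_one]

lemma sum_powerset_powerset (S : Finset (Fin n)) (F : Finset (Fin n) → Finset (Fin n) → ℝ) :
    ∑ A ∈ S.powerset, ∑ B ∈ A.powerset, F A B
      = ∑ B ∈ S.powerset, ∑ D ∈ (S \ B).powerset, F (B ∪ D) B := by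
  rw [Finset.sum_sigma', Finset.sum_sigma']
  refine Finset.sum_bij' (fun x _ => ⟨x.2, x.1 \ x.2⟩) (fun x _ => ⟨x.1 ∪ x.2, x.1⟩) ?_ ?_ ?_ ?_ ?_
  · rintro ⟨A, B⟩ h
    simp only [Finset.mem_sigma, Finset.mem_powerset] at h ⊢
    exact ⟨h.2.trans h.1, Finset.sdiff_subset_sdiff h.1 le_rfl⟩
  · rintro ⟨A, B⟩ h
    simp only [Finset.mem_sigma, Finset.mem_powerset] at h ⊢
    exact ⟨Finset.union_subset h.1 (h.2.trans Finset.sdiff_subset), Finset.subset_union_left⟩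
  · rintro ⟨A, B⟩ h
    simp only [Finset.mem_sigma, Finset.mem_powerset] at h
    simp [Finset.union_eq_right.2 h.2]
  · rintro ⟨A, B⟩ h
    simp only [Finset.mem_sigma, Finset.mem_powerset] at h
    have : Disjoint A B := (Finset.disjoint_of_subset_left h.2 Finset.sdiff_disjoint).symm
    simp [Finset.union_sdiff_cancel_left this]
  · rintro ⟨A, B⟩ h
    simp only [Finset.mem_sigma, Finset.mem_powerset] at h
    simp [Finset.union_eq_right.2 h.2]

lemma mul_assoc' (ω θ η : DF n) : mul (mul ω θ) η = mul ω (mul θ η) := by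
  funext S T
  have h1 : mul (mul ω θ) η S T = ∑ A ∈ S.powerset, ∑ B ∈ A.powerset,
      ∑ C ∈ T.powerset, ∑ D ∈ C.powerset,
      shuffleSign A (S \ A) * shuffleSign C (T \ C) *
        (shuffleSign B (A \ B) * shuffleSign D (C \ D) * ω B D * θ (A \ B) (C \ D))
        * η (S \ A) (T \ C) := by
    simp only [mul, Finset.mul_sum, Finset.sum_mul]
    refine Finset.sum_congr rfl fun A _ => ?_
    exact Finset.sum_comm
  have h2 : mul ω (mul θ η) S T = ∑ B ∈ S.powerset, ∑ A ∈ (S \ B).powerset,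
      ∑ D ∈ T.powerset, ∑ C ∈ (T \ D).powerset,
      shuffleSign B (S \ B) * shuffleSign D (T \ D) * ω B D *
        (shuffleSign A ((S \ B) \ A) * shuffleSign C ((T \ D) \ C) * θ A C *
          η ((S \ B) \ A) ((T \ D) \ C)) := by
    simp only [mul, Finset.mul_sum]
    refine Finset.sum_congr rfl fun A _ => ?_
    exact Finset.sum_comm
  have aux : ∀ S B A : Finset (Fin n), B ⊆ S → A ⊆ S \ B →
      (B ∪ A) \ B = A ∧ S \ (B ∪ A) = (S \ B) \ A ∧
      shuffleSign (B ∪ A) ((S \ B) \ A) * shuffleSign B A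
        = shuffleSign B (S \ B) * shuffleSign A ((S \ B) \ A) := by
    intro S B A hB hA
    have hd : Disjoint B A := (Finset.disjoint_of_subset_left hA Finset.sdiff_disjoint).symm
    refine ⟨Finset.union_sdiff_cancel_left hd, by rw [sdiff_sdiff_left]; rfl, ?_⟩
    have : S \ B = A ∪ ((S \ B) \ A) := (Finset.union_sdiff_of_subset hA).symm
    rw [shuffleSign_union_left _ _ _ hd]
    conv_rhs => rw [this]
    rw [shuffleSign_union_right _ _ _ Finset.disjoint_sdiff, ← this]
    ring
  rw [h1, h2, sum_powerset_powerset]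
  refine Finset.sum_congr rfl fun B hB => Finset.sum_congr rfl fun A hA => ?_
  rw [sum_powerset_powerset]
  refine Finset.sum_congr rfl fun D hD => Finset.sum_congr rfl fun C hC => ?_
  obtain ⟨a1, a2, a3⟩ := aux S B A (Finset.mem_powerset.1 hB) (Finset.mem_powerset.1 hA)
  obtain ⟨b1, b2, b3⟩ := aux T D C (Finset.mem_powerset.1 hD) (Finset.mem_powerset.1 hC)
  rw [a1, a2, b1, b2]
  linear_combination (ω B D * θ A C * η ((S \ B) \ A) ((T \ D) \ C)) *
    (shuffleSign (D ∪ C) ((T \ D) \ C) * shuffleSign D C * a3 +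
     shuffleSign B (S \ B) * shuffleSign A ((S \ B) \ A) * b3)

lemma mul_comm' {ω θ : DF n} {p q : ℕ} (hω : IsDeg p ω) (hθ : IsDeg q θ) :
    mul ω θ = mul θ ω := by
  funext S T
  have refl : ∀ (S : Finset (Fin n)) (F : Finset (Fin n) → ℝ),
      ∑ A ∈ S.powerset, F A = ∑ A ∈ S.powerset, F (S \ A) := by
    intro S F
    refine Finset.sum_bij' (fun A _ => S \ A) (fun A _ => S \ A) ?_ ?_ ?_ ?_ ?_
    · intro A _; simp
    · intro A _; simp
    · intro A hA; simpa using Finset.mem_powerset.1 hA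
    · intro A hA; simpa using Finset.mem_powerset.1 hA
    · intro A hA
      rw [Finset.sdiff_sdiff_eq_self (Finset.mem_powerset.1 hA)]
  unfold mul
  rw [refl]
  refine Finset.sum_congr rfl fun A hA => ?_
  rw [refl]
  refine Finset.sum_congr rfl fun C hC => ?_
  rw [Finset.sdiff_sdiff_eq_self (Finset.mem_powerset.1 hA),
    Finset.sdiff_sdiff_eq_self (Finset.mem_powerset.1 hC)]
  by_cases h1 : ω (S \ A) (T \ C) = 0
  · simp [h1]
  by_cases h2 : θ A C = 0
  · simp [h2]
  obtain ⟨c1, c2⟩ := hω _ _ h1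
  obtain ⟨c3, c4⟩ := hθ _ _ h2
  rw [shuffleSign_comm _ _ Finset.sdiff_disjoint, shuffleSign_comm _ _ Finset.sdiff_disjoint,
    c1, c2, c3, c4]
  have : ((-1 : ℝ) ^ (p * q)) * (-1) ^ (p * q) = 1 := by
    rw [← pow_add, ← two_mul, pow_mul]; simp
  linear_combination (shuffleSign A (S \ A) * shuffleSign C (T \ C) * θ A C *
    ω (S \ A) (T \ C)) * this

lemma isDeg_mul {ω θ : DF n} {p q : ℕ} (hω : IsDeg p ω) (hθ : IsDeg q θ) :
    IsDeg (p + q) (mul ω θ) := by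
  intro S T h
  obtain ⟨A, hA, h⟩ := Finset.exists_ne_zero_of_sum_ne_zero h
  obtain ⟨C, hC, h⟩ := Finset.exists_ne_zero_of_sum_ne_zero h
  rw [Finset.mem_powerset] at hA hC
  obtain ⟨c3, c4⟩ := hθ _ _ (right_ne_zero_of_mul h)
  obtain ⟨c1, c2⟩ := hω _ _ (right_ne_zero_of_mul (left_ne_zero_of_mul h))
  have := Finset.card_sdiff_add_card_eq_card hA
  have := Finset.card_sdiff_add_card_eq_card hC
  omega

lemma isDeg_one : IsDeg 0 (one n) := by
  intro S T h
  unfold one at h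
  split_ifs at h with h1
  · simp [h1]
  · exact absurd rfl h

lemma isDeg_pow {ω : DF n} (hω : IsDeg 1 ω) (k : ℕ) : IsDeg k (pow ω k) := by
  induction k with
  | zero => exact isDeg_one
  | succ k ih => exact isDeg_mul ih hω

lemma one_mul' (ω : DF n) : mul (one n) ω = ω := by
  funext S T
  unfold mul
  rw [Finset.sum_eq_single ∅, Finset.sum_eq_single ∅]
  · simp [one, shuffleSign]
  · intro b _ hb; simp [one, hb]
  · simp
  · intro b _ hb; simp [one, hb]
  · simp

lemma mul_pow' {g a : DF n} (hg : IsDeg 1 g) (ha : IsDeg 1 a) (k : ℕ) :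
    pow (mul g a) k = mul (pow g k) (pow a k) := by
  induction k with
  | zero => exact (one_mul' _).symm
  | succ k ih =>
    simp only [pow]
    rw [ih, mul_assoc', ← mul_assoc' _ g a, mul_comm' (isDeg_pow ha k) hg, mul_assoc' g,
      ← mul_assoc' _ g]

lemma sum_insert_powersetCard (r : ℕ) (f : Finset (Fin n) → ℝ) :
    ∑ S ∈ Finset.powersetCard r univ, ∑ i ∈ Sᶜ, f (insert i S)
      = (r + 1) * ∑ S ∈ Finset.powersetCard (r + 1) univ, f S := by
  have : (r + 1 : ℝ) * ∑ S ∈ Finset.powersetCard (r + 1) (univ : Finset (Fin n)), f S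
      = ∑ S ∈ Finset.powersetCard (r + 1) univ, ∑ i ∈ S, f S := by
    rw [Finset.mul_sum]
    refine Finset.sum_congr rfl fun S hS => ?_
    rw [Finset.sum_const, (Finset.mem_powersetCard.1 hS).2]
    simp
  rw [this, Finset.sum_sigma', Finset.sum_sigma']
  refine Finset.sum_bij' (fun x _ => ⟨insert x.2 x.1, x.2⟩) (fun x _ => ⟨x.1.erase x.2, x.2⟩)
    ?_ ?_ ?_ ?_ ?_
  · rintro ⟨S, i⟩ h
    simp only [Finset.mem_sigma, Finset.mem_powersetCard, Finset.mem_compl] at h ⊢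
    exact ⟨⟨Finset.subset_univ _, by rw [Finset.card_insert_of_notMem h.2, h.1.2]⟩,
      Finset.mem_insert_self _ _⟩
  · rintro ⟨S, i⟩ h
    simp only [Finset.mem_sigma, Finset.mem_powersetCard, Finset.mem_compl] at h ⊢
    exact ⟨⟨Finset.subset_univ _, by rw [Finset.card_erase_of_mem h.2, h.1.2]; rfl⟩,
      Finset.notMem_erase _ _⟩
  · rintro ⟨S, i⟩ h
    simp only [Finset.mem_sigma, Finset.mem_powersetCard, Finset.mem_compl] at h
    simp [Finset.erase_insert h.2]
  · rintro ⟨S, i⟩ h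
    simp only [Finset.mem_sigma, Finset.mem_powersetCard] at h
    simp [Finset.insert_erase h.2]
  · rintro ⟨S, i⟩ h
    rfl

lemma contrN_scalar (r : ℕ) (ω : DF n) :
    toScalar (contrN r ω) = r.factorial * ∑ S ∈ Finset.powersetCard r univ, ω S S := by
  induction r generalizing ω with
  | zero => simp [contrN, toScalar]
  | succ r ih =>
    have : contrN (r + 1) ω = contrN r (contr ω) := rfl
    rw [this, ih, Nat.factorial_succ]
    have h2 : ∀ S, contr ω S S = ∑ i ∈ Sᶜ, ω (insert i S) (insert i S) := by
      intro S
      unfold contr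
      simp only [or_self, shuffleSign_sq, _root_.one_mul]
      rw [← Finset.sum_filter_add_sum_filter_not univ (fun i => i ∈ S)]
      rw [Finset.sum_eq_zero, zero_add]
      · refine Finset.sum_congr (by ext; simp) fun i hi => ?_
        rw [if_neg (by simpa using hi)]
      · intro i hi
        rw [if_pos (by simpa using hi)]
    simp only [h2]
    rw [sum_insert_powersetCard r (fun S => ω S S)]
    push_cast
    ring

lemma shuffleSign_singleton (S : Finset (Fin n)) {k : ℕ} (h : S.card = k) (a : Fin k) :
    shuffleSign {S.orderEmbOfFin h a} (S \ {S.orderEmbOfFin h a}) = (-1) ^ (a : ℕ) := by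
  unfold shuffleSign
  rw [Finset.sum_singleton]
  congr 1
  have : (S \ {S.orderEmbOfFin h a}).filter (fun b => b < S.orderEmbOfFin h a)
      = (Finset.Iio a).map (S.orderEmbOfFin h).toEmbedding := by
    ext b
    simp only [Finset.mem_filter, Finset.mem_sdiff, Finset.mem_singleton, Finset.mem_map,
      Finset.mem_Iio]
    constructor
    · rintro ⟨⟨hb, -⟩, hlt⟩
      have : b ∈ Set.range (S.orderEmbOfFin h) := by simpa using hb
      obtain ⟨c, rfl⟩ := this
      exact ⟨c, by simpa using hlt, rfl⟩
    · rintro ⟨c, hc, rfl⟩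
      have : S.orderEmbOfFin h c < S.orderEmbOfFin h a := by simpa using hc
      exact ⟨⟨by simp, this.ne⟩, this⟩
  rw [this, Finset.card_map]
  simp

lemma mul_deg_one {ω θ : DF n} (hω : IsDeg 1 ω) (S T : Finset (Fin n)) :
    mul ω θ S T = ∑ i ∈ S, ∑ j ∈ T, shuffleSign {i} (S \ {i}) * shuffleSign {j} (T \ {j}) *
      ω {i} {j} * θ (S \ {i}) (T \ {j}) := by
  have key : ∀ (S : Finset (Fin n)) (F : Finset (Fin n) → ℝ), (∀ A, A.card ≠ 1 → F A = 0) →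
      ∑ A ∈ S.powerset, F A = ∑ i ∈ S, F {i} := by
    intro S F hF
    symm
    have : ∑ i ∈ S, F {i} = ∑ A ∈ S.map ⟨fun i => {i}, Finset.singleton_injective⟩, F A := by
      rw [Finset.sum_map]; rfl
    rw [this]
    refine Finset.sum_subset ?_ ?_
    · intro A hA
      simp only [Finset.mem_map, Function.Embedding.coeFn_mk] at hA
      obtain ⟨i, hi, rfl⟩ := hA
      simpa using hi
    · intro A hA hA'
      refine hF A fun hc => hA' ?_
      obtain ⟨i, rfl⟩ := Finset.card_eq_one.1 hc
      simp only [Finset.mem_map, Function.Embedding.coeFn_mk]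
      exact ⟨i, by simpa using hA, rfl⟩
  have hz : ∀ A C, (A.card ≠ 1 ∨ C.card ≠ 1) → ω A C = 0 := by
    intro A C h
    by_contra h'
    have := hω A C h'
    omega
  unfold mul
  rw [key]
  · refine Finset.sum_congr rfl fun i _ => ?_
    rw [key]
    intro C hC
    rw [hz _ _ (Or.inr hC)]; ring
  · intro A hA
    refine Finset.sum_eq_zero fun C _ => ?_
    rw [hz _ _ (Or.inl hA)]; ring

lemma pow_eq_det {ω : DF n} (hω : IsDeg 1 ω) (k : ℕ) (S T : Finset (Fin n))
    (hS : S.card = k) (hT : T.card = k) :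
    pow ω k S T = k.factorial *
      (Matrix.of fun a b => ω {S.orderEmbOfFin hS a} {T.orderEmbOfFin hT b}).det := by
  induction k generalizing S T with
  | zero =>
    rw [Finset.card_eq_zero] at hS hT
    subst hS hT
    simp [pow, one]
  | succ k ih =>
    simp only [pow]
    rw [mul_comm' (isDeg_pow hω k) hω, mul_deg_one hω]
    have reS : ∀ (S : Finset (Fin n)) (hS : S.card = k + 1) (F : Fin n → ℝ),
        ∑ i ∈ S, F i = ∑ a, F (S.orderEmbOfFin hS a) := by
      intro S hS F
      conv_lhs => rw [← Finset.map_orderEmbOfFin_univ S hS]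
      rw [Finset.sum_map]; rfl
    rw [reS S hS]
    have hrow : ∀ a : Fin (k + 1), ∑ j ∈ T, shuffleSign {S.orderEmbOfFin hS a}
        (S \ {S.orderEmbOfFin hS a}) * shuffleSign {j} (T \ {j}) *
        ω {S.orderEmbOfFin hS a} {j} * pow ω k (S \ {S.orderEmbOfFin hS a}) (T \ {j})
        = k.factorial *
          (Matrix.of fun a b => ω {S.orderEmbOfFin hS a} {T.orderEmbOfFin hT b}).det := by
      intro a
      rw [reS T hT, Matrix.det_succ_row _ a, Finset.mul_sum]
      refine Finset.sum_congr rfl fun b _ => ?_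
      rw [shuffleSign_singleton, shuffleSign_singleton]
      have cd : ∀ (S : Finset (Fin n)) (hS : S.card = k + 1) (a : Fin (k + 1)),
          (S \ {S.orderEmbOfFin hS a}).card = k := by
        intro S hS a
        rw [Finset.card_sdiff_of_subset (by simp), hS]; simp
      have em : ∀ (S : Finset (Fin n)) (hS : S.card = k + 1) (a : Fin (k + 1)) (c : Fin k),
          (S \ {S.orderEmbOfFin hS a}).orderEmbOfFin (cd S hS a) c
            = S.orderEmbOfFin hS (a.succAbove c) := by
        intro S hS a c
        have := Finset.orderEmbOfFin_unique (cd S hS a)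
          (f := fun c => S.orderEmbOfFin hS (a.succAbove c)) (by
            intro x
            simp [Fin.succAbove_ne])
          ((S.orderEmbOfFin hS).strictMono.comp (Fin.strictMono_succAbove a))
        exact (congrFun this c).symm
      rw [ih _ _ (cd S hS a) (cd T hT b)]
      simp only [em]
      have : (Matrix.of fun a b => ω {S.orderEmbOfFin hS a} {T.orderEmbOfFin hT b}).submatrix
          a.succAbove b.succAbove = Matrix.of fun a_1 b_1 =>
            ω {S.orderEmbOfFin hS (a.succAbove a_1)} {T.orderEmbOfFin hT (b.succAbove b_1)} := rfl
      rw [this, Matrix.of_apply, pow_add]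
      ring
    simp only [hrow]
    rw [Finset.sum_const, Nat.factorial_succ]
    simp
    ring

lemma isDeg_gm : IsDeg 1 (gm n) := by
  intro S T h
  unfold gm at h
  split_ifs at h with h1
  · exact ⟨h1.2, h1.1 ▸ h1.2⟩
  · exact absurd rfl h

lemma pow_gm (k : ℕ) (S T : Finset (Fin n)) :
    pow (gm n) k S T = if S = T ∧ S.card = k then (k.factorial : ℝ) else 0 := by
  by_cases hS : S.card = k ∧ T.card = k
  · obtain ⟨hS, hT⟩ := hS
    rw [pow_eq_det isDeg_gm k S T hS hT]
    by_cases h : S = T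
    · subst h
      rw [if_pos ⟨rfl, hS⟩]
      have : (Matrix.of fun a b => gm n {S.orderEmbOfFin hS a} {S.orderEmbOfFin hT b}) = 1 := by
        ext a b
        simp [gm, Matrix.one_apply]
      rw [this]; simp
    · rw [if_neg (fun h' => h h'.1)]
      have : ∃ i ∈ S, i ∉ T := by
        by_contra hc
        push Not at hc
        exact h (Finset.eq_of_subset_of_card_le hc (by omega))
      obtain ⟨i, hi, hiT⟩ := this
      have : i ∈ Set.range (S.orderEmbOfFin hS) := by simpa using hi
      obtain ⟨a, rfl⟩ := this
      rw [Matrix.det_eq_zero_of_row_eq_zero a, mul_zero]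
      intro b
      simp only [Matrix.of_apply, gm, Finset.singleton_inj]
      rw [if_neg]
      rintro ⟨h, -⟩
      apply hiT
      rw [h]; simp
  · rw [if_neg]
    · by_contra h
      exact hS (isDeg_pow isDeg_gm k S T h)
    · rintro ⟨rfl, h⟩
      exact hS ⟨h, h⟩

lemma diag_mul (k : ℕ) {θ : DF n} (hθ : IsDeg k θ) (S : Finset (Fin n)) :
    mul (pow (gm n) k) θ S S =
      ∑ B ∈ S.powerset, if B.card = k then (k.factorial : ℝ) * θ (S \ B) (S \ B) else 0 := by
  unfold mul
  refine Finset.sum_congr rfl fun B hB => ?_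
  rw [Finset.sum_eq_single B]
  · rw [pow_gm, shuffleSign_sq]
    by_cases h : B.card = k <;> simp [h]
  · intro C _ hC
    rw [pow_gm, if_neg (fun h => hC h.1.symm)]; ring
  · intro h; exact absurd hB h

lemma sum_diag (k : ℕ) {θ : DF n} (hθ : IsDeg k θ) :
    ∑ S ∈ Finset.powersetCard (2 * k) univ, mul (pow (gm n) k) θ S S =
      k.factorial * ((n - k).choose k) * ∑ D ∈ Finset.powersetCard k univ, θ D D := by
  simp only [diag_mul k hθ, ← Finset.sum_filter]
  have : (k.factorial * ((n - k).choose k) : ℝ) * ∑ D ∈ Finset.powersetCard k univ, θ D D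
      = ∑ D ∈ Finset.powersetCard k univ, ∑ B ∈ Finset.powersetCard k Dᶜ,
          (k.factorial : ℝ) * θ D D := by
    rw [Finset.mul_sum]
    refine Finset.sum_congr rfl fun D hD => ?_
    rw [Finset.sum_const, Finset.card_powersetCard, Finset.card_compl,
      (Finset.mem_powersetCard.1 hD).2]
    simp
    ring
  rw [this, Finset.sum_sigma', Finset.sum_sigma']
  refine Finset.sum_bij' (fun x _ => ⟨x.1 \ x.2, x.2⟩) (fun x _ => ⟨x.1 ∪ x.2, x.2⟩)
    ?_ ?_ ?_ ?_ ?_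
  · rintro ⟨S, B⟩ h
    simp only [Finset.mem_sigma, Finset.mem_powersetCard, Finset.mem_filter,
      Finset.mem_powerset] at h ⊢
    obtain ⟨⟨-, h1⟩, h2, h3⟩ := h
    have := Finset.card_sdiff_add_card_eq_card h2
    refine ⟨⟨Finset.subset_univ _, by omega⟩, ?_, h3⟩
    intro x hx
    simp [hx]
  · rintro ⟨D, B⟩ h
    simp only [Finset.mem_sigma, Finset.mem_powersetCard, Finset.mem_filter,
      Finset.mem_powerset] at h ⊢
    obtain ⟨⟨-, h1⟩, h2, h3⟩ := h
    have hd : Disjoint D B := (Finset.subset_compl_iff_disjoint_left.1 h2)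
    refine ⟨⟨Finset.subset_univ _, ?_⟩, Finset.subset_union_right, h3⟩
    rw [Finset.card_union_of_disjoint hd]; omega
  · rintro ⟨S, B⟩ h
    simp only [Finset.mem_sigma, Finset.mem_filter, Finset.mem_powerset] at h
    simp [Finset.union_eq_left.2 h.2.1]
  · rintro ⟨D, B⟩ h
    simp only [Finset.mem_sigma, Finset.mem_powersetCard] at h
    have hd : Disjoint D B := (Finset.subset_compl_iff_disjoint_left.1 h.2.1)
    simp [Finset.union_sdiff_cancel_right hd]
  · rintro ⟨S, B⟩ h
    rfl

lemma sum_pow_diag {ω : DF n} (hω : IsDeg 1 ω) (k : ℕ) (hk : k ≤ n)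
    (hsymm : ∀ i j, ω {i} {j} = ω {j} {i}) :
    ∑ D ∈ Finset.powersetCard k univ, pow ω k D D = k.factorial * sigma k ω := by
  have hH : (Matrix.of fun i j => ω {i} {j} : Matrix (Fin n) (Fin n) ℝ).IsHermitian := by
    ext i j
    simp [hsymm i j]
  set M := (Matrix.of fun i j => ω {i} {j} : Matrix (Fin n) (Fin n) ℝ) with hM
  have h1 : sigma k ω = ∑ s ∈ Finset.powersetCard k univ,
      (M.submatrix (Subtype.val : s → Fin n) (Subtype.val : s → Fin n)).det := by
    unfold sigma
    rw [dif_pos hH]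
    have e1 := Matrix.charpoly_coeff_eq_sum_minors M k (by simpa using hk)
    have e2 : M.charpoly.coeff (Fintype.card (Fin n) - k)
        = (-1) ^ k * ∑ s ∈ Finset.powersetCard k univ, ∏ i ∈ s, hH.eigenvalues i := by
      rw [hH.charpoly_eq]
      have := Finset.prod_X_add_C_coeff (univ : Finset (Fin n)) (fun i => - hH.eigenvalues i)
        (k := n - k) (by simp)
      simp only [Finset.card_univ, Fintype.card_fin] at this ⊢
      simp only [map_neg, ← sub_eq_add_neg] at this
      rw [show n - (n - k) = k by omega] at this
      refine this.trans ?_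
      rw [Finset.mul_sum]
      refine Finset.sum_congr rfl fun s hs => ?_
      rw [Finset.prod_neg, (Finset.mem_powersetCard.1 hs).2]
    rw [e2] at e1
    exact mul_left_cancel₀ (by simp) e1
  rw [h1, Finset.mul_sum]
  refine Finset.sum_congr rfl fun D hD => ?_
  have hc := (Finset.mem_powersetCard.1 hD).2
  rw [pow_eq_det hω k D D hc hc]
  congr 1
  rw [← Matrix.det_submatrix_equiv_self (D.orderIsoOfFin hc).toEquiv]
  rfl

end DF


/-- If `R = gA` is the product of the metric with a symmetric bilinear
form `A` (conformally flat algebraic curvature tensor), then for `0 ≤ 2k ≤ n`,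
`h_{2k} = c^{2k}(gA)^k/(2k)! = ((n−k)!·k!/(n−2k)!)·σ_k(A)`. -/
theorem stmt2_gaussBonnet_conformally_flat
    (n k : ℕ) (hk : 2 * k ≤ n)
    (V : Type*) [NormedAddCommGroup V] [InnerProductSpace ℝ V]
    (hV : Module.finrank ℝ V = n)
    (e : OrthonormalBasis (Fin n) ℝ V)
    (A : V → V → ℝ) (hbil : IsBilin A) (hsymm : IsSymmBilin A) :
    DF.toScalar (DF.contrN (2 * k) (DF.pow (DF.mul (DF.gm n) (ofBilin e A)) k)) /
        (((2 * k).factorial : ℕ) : ℝ) =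
      ((((n - k).factorial * k.factorial : ℕ) : ℝ) / (((n - 2 * k).factorial : ℕ) : ℝ)) *
        DF.sigma k (ofBilin e A) := by
  have hd : DF.IsDeg 1 (ofBilin e A) := by
    intro S T h
    by_contra hc
    apply h
    unfold ofBilin ofForm
    rw [dif_neg hc]
  have hval : ∀ i j, ofBilin e A {i} {j} = A (e i) (e j) := by
    intro i j
    unfold ofBilin ofForm
    rw [dif_pos (by simp)]
    have hs : ∀ (i : Fin n) (h : ({i} : Finset (Fin n)).card = 1),
        ((({i} : Finset (Fin n)).orderIsoOfFin h 0 : _) : Fin n) = i := fun i h =>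
      Finset.mem_singleton.1 (Subtype.prop _)
    beta_reduce
    rw [hs, hs]
  rw [DF.contrN_scalar, DF.mul_pow' DF.isDeg_gm hd, DF.sum_diag k (DF.isDeg_pow hd k),
    DF.sum_pow_diag hd k (by omega) (fun i j => by rw [hval, hval, hsymm])]
  have hch := Nat.choose_mul_factorial_mul_factorial (n := n - k) (k := k) (by omega)
  rw [show n - k - k = n - 2 * k by omega] at hch
  have h1 : ((2 * k).factorial : ℝ) ≠ 0 := by exact_mod_cast Nat.factorial_ne_zero _
  have h2 : ((n - 2 * k).factorial : ℝ) ≠ 0 := by exact_mod_cast Nat.factorial_ne_zero _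
  rw [← hch]
  push_cast
  field_simp
end

section
/- Generalized Newton trace formula: let ω be a symmetric (p,p)-double form satisfying the first Bianchi identity on an n-dimensional real inner product space (V,g), with p ≥ 1 and k ≥ 1 integers such that p(k+1) ≤ n. Then ⟨ Σ_{r=pk−p}^{pk} (−1)^{r+pk} · g^{p−pk+r} c^r(ω^k) / ((p−pk+r)!·r!) , ω ⟩ = c^{pk+p}(ω^{k+1}) / (pk+p)!, where the left-hand sum is the k-th Newton transformation N_k(ω) expressed by its explicit contraction formula. -/
/-!
Double forms on an `n`-dimensional real inner product space `(V, g)`, represented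
by their components with respect to a (fixed) orthonormal basis: a `(p,q)`-double
form is determined by its values on pairs of increasingly ordered tuples of
distinct basis vectors, i.e. by a function `Finset (Fin n) → Finset (Fin n) → ℝ`
(supported on pairs of sets of cardinalities `p` and `q`).
-/

open Finset

namespace NewtonAux

variable {n : ℕ}

theorem sgn_eq (A B : Finset (Fin n)) :
    DF.shuffleSign A B = ∏ a ∈ A, ∏ b ∈ B, (if b < a then (-1 : ℝ) else 1) := by
  unfold DF.shuffleSign
  rw [← Finset.prod_pow_eq_pow_sum]
  refine Finset.prod_congr rfl fun a _ => ?_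
  rw [Finset.prod_ite]
  simp

theorem sgn_union_left {A B : Finset (Fin n)} (C : Finset (Fin n)) (h : Disjoint A B) :
    DF.shuffleSign (A ∪ B) C = DF.shuffleSign A C * DF.shuffleSign B C := by
  simp only [sgn_eq, Finset.prod_union h]

theorem sgn_union_right (C : Finset (Fin n)) {A B : Finset (Fin n)} (h : Disjoint A B) :
    DF.shuffleSign C (A ∪ B) = DF.shuffleSign C A * DF.shuffleSign C B := by
  simp only [sgn_eq, Finset.prod_union h, Finset.prod_mul_distrib]

theorem sgn_insert_left {i : Fin n} {A : Finset (Fin n)} (C : Finset (Fin n)) (h : i ∉ A) :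
    DF.shuffleSign (insert i A) C = DF.shuffleSign {i} C * DF.shuffleSign A C := by
  simp only [sgn_eq, Finset.prod_insert h, Finset.prod_singleton]

theorem sgn_insert_right {i : Fin n} {A : Finset (Fin n)} (C : Finset (Fin n)) (h : i ∉ A) :
    DF.shuffleSign C (insert i A) = DF.shuffleSign C {i} * DF.shuffleSign C A := by
  simp only [sgn_eq, Finset.prod_insert h, Finset.prod_singleton, Finset.prod_mul_distrib]

theorem sgn_sq (A B : Finset (Fin n)) : DF.shuffleSign A B * DF.shuffleSign A B = 1 := by
  unfold DF.shuffleSign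
  rw [← mul_pow]; simp

theorem sgn_swap {A B : Finset (Fin n)} (h : Disjoint A B) :
    DF.shuffleSign A B = (-1 : ℝ) ^ (A.card * B.card) * DF.shuffleSign B A := by
  have key : DF.shuffleSign A B * DF.shuffleSign B A = (-1 : ℝ) ^ (A.card * B.card) := by
    simp only [sgn_eq]
    rw [Finset.prod_comm (s := B) (t := A), ← Finset.prod_mul_distrib]
    have : ∀ a ∈ A, ((∏ b ∈ B, if b < a then (-1 : ℝ) else 1) *
        ∏ b ∈ B, if a < b then (-1 : ℝ) else 1) = (-1) ^ B.card := by
      intro a ha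
      rw [← Finset.prod_mul_distrib, ← Finset.prod_const]
      refine Finset.prod_congr rfl fun b hb => ?_
      have hab : a ≠ b := fun e => Finset.disjoint_left.1 h ha (e ▸ hb)
      rcases lt_or_gt_of_ne hab with h1 | h1
      · simp [h1, h1.not_gt]
      · simp [h1, h1.not_gt]
    rw [Finset.prod_congr rfl this, Finset.prod_const, ← pow_mul, mul_comm]
  rw [← key, mul_assoc, sgn_sq, mul_one]

theorem sgn_empty_right (A : Finset (Fin n)) : DF.shuffleSign A ∅ = 1 := by
  simp [sgn_eq]

theorem sum_insert_reindex (i : Fin n) (f : Finset (Fin n) → ℝ) :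
    (∑ R : Finset (Fin n), if i ∉ R then f (insert i R) else 0)
      = ∑ R : Finset (Fin n), if i ∈ R then f R else 0 := by
  rw [← Finset.sum_filter, ← Finset.sum_filter]
  refine Finset.sum_nbij' (fun R => insert i R) (fun R => R.erase i) ?_ ?_ ?_ ?_ ?_
  · simp
  · simp
  · intro R hR; simp at hR; simp [hR]
  · intro R hR; simp at hR; simp [hR]
  · simp

theorem sum_powerset_reindex (f : Finset (Fin n) → Finset (Fin n) → Finset (Fin n) → ℝ) :
    (∑ S : Finset (Fin n), ∑ A ∈ S.powerset, f A (S \ A) S)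
      = ∑ A : Finset (Fin n), ∑ B : Finset (Fin n),
          if Disjoint A B then f A B (A ∪ B) else 0 := by
  rw [Finset.sum_sigma', ← Finset.sum_product', ← Finset.sum_filter]
  refine Finset.sum_nbij' (fun x => (x.2, x.1 \ x.2)) (fun x => ⟨x.1 ∪ x.2, x.1⟩) ?_ ?_ ?_ ?_ ?_
  · rintro ⟨S, A⟩ h
    simpa using Finset.disjoint_sdiff
  · rintro ⟨A, B⟩ h
    exact Finset.mem_sigma.2 ⟨Finset.mem_univ _,
      Finset.mem_powerset.2 Finset.subset_union_left⟩
  · rintro ⟨S, A⟩ h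
    simp at h
    simp [h]
  · rintro ⟨A, B⟩ h
    simp at h
    simp [Finset.union_sdiff_cancel_left h]
  · rintro ⟨S, A⟩ h
    simp at h
    simp only [Finset.union_sdiff_of_subset h]

theorem contrN_eq (r : ℕ) (ω : DF n) (S T : Finset (Fin n)) :
    DF.contrN r ω S T = (r.factorial : ℝ) * ∑ R : Finset (Fin n),
      if R.card = r ∧ Disjoint R S ∧ Disjoint R T then
        DF.shuffleSign R S * DF.shuffleSign R T * ω (R ∪ S) (R ∪ T) else 0 := by
  induction r generalizing S T with
  | zero =>
    rw [Finset.sum_eq_single ∅]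
    · simp [DF.contrN, sgn_eq]
    · intro R _ hR
      simp [hR]
    · simp
  | succ r ih =>
    have h0 : DF.contrN (r + 1) ω = DF.contr (DF.contrN r ω) := by
      simp [DF.contrN, Function.iterate_succ_apply']
    rw [h0]
    unfold DF.contr
    set f : Finset (Fin n) → ℝ := fun R =>
      if R.card = r + 1 ∧ Disjoint R S ∧ Disjoint R T then
        DF.shuffleSign R S * DF.shuffleSign R T * ω (R ∪ S) (R ∪ T) else 0 with hf
    have step : ∀ i : Fin n, (if i ∈ S ∨ i ∈ T then (0 : ℝ)
        else DF.shuffleSign {i} S * DF.shuffleSign {i} T *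
          DF.contrN r ω (insert i S) (insert i T))
        = (r.factorial : ℝ) * ∑ R : Finset (Fin n), if i ∈ R then f R else 0 := by
      intro i
      rw [← sum_insert_reindex]
      split_ifs with hi
      · symm
        rw [Finset.sum_eq_zero, mul_zero]
        intro R _
        by_cases h1 : i ∈ R
        · simp [h1]
        · rw [if_pos h1]
          simp only [hf]
          rw [if_neg]
          rintro ⟨_, h2, h3⟩
          simp at h2 h3
          tauto
      · rw [ih, mul_left_comm, Finset.mul_sum]
        congr 1
        refine Finset.sum_congr rfl fun R _ => ?_
        push Not at hi
        by_cases hR : i ∈ R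
        · simp [hR]
        · simp only [hf, hR, not_false_eq_true, if_true, Finset.card_insert_of_notMem,
            Finset.disjoint_insert_right, Finset.disjoint_insert_left, hi, true_and,
            Nat.add_right_cancel_iff, mul_ite, mul_zero]
          split_ifs with h
          · rw [sgn_insert_left _ hR, sgn_insert_left _ hR, sgn_insert_right _ hi.1,
              sgn_insert_right _ hi.2, Finset.union_insert, Finset.union_insert,
              Finset.insert_union, Finset.insert_union]
            have := sgn_sq R {i}
            linear_combination (DF.shuffleSign {i} S * DF.shuffleSign {i} T *
              DF.shuffleSign R S * DF.shuffleSign R T *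
              ω (insert i (R ∪ S)) (insert i (R ∪ T))) * this
          · rfl
    rw [Finset.sum_congr rfl fun i _ => step i, ← Finset.mul_sum, Finset.sum_comm,
      Nat.factorial_succ]
    push_cast
    rw [mul_comm ((r : ℝ) + 1), mul_assoc]
    congr 1
    rw [Finset.mul_sum]
    refine Finset.sum_congr rfl fun R _ => ?_
    rw [← Finset.sum_filter]
    simp only [Finset.filter_univ_mem, Finset.sum_const, nsmul_eq_mul]
    simp only [hf]
    split_ifs with h
    · rw [h.1]; push_cast; ring
    · simp

theorem pow_gm_eq (a : ℕ) (S T : Finset (Fin n)) :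
    DF.pow (DF.gm n) a S T = if S = T ∧ S.card = a then (a.factorial : ℝ) else 0 := by
  induction a generalizing S T with
  | zero =>
    simp only [DF.pow, DF.one, Finset.card_eq_zero, Nat.factorial_zero, Nat.cast_one]
    congr 1
    apply propext
    constructor
    · rintro ⟨rfl, rfl⟩; simp
    · rintro ⟨rfl, rfl⟩; simp
  | succ a ih =>
    simp only [DF.pow, DF.mul, ih, DF.gm]
    by_cases hST : S = T
    · subst hST
      have step : ∀ A ∈ S.powerset, (∑ C ∈ S.powerset,
          DF.shuffleSign A (S \ A) * DF.shuffleSign C (S \ C) *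
            (if A = C ∧ A.card = a then (a.factorial : ℝ) else 0) *
            (if S \ A = S \ C ∧ (S \ A).card = 1 then (1 : ℝ) else 0))
          = if A.card = a ∧ S.card = a + 1 then (a.factorial : ℝ) else 0 := by
        intro A hA
        rw [Finset.sum_eq_single_of_mem A hA]
        · rw [sgn_sq]
          have := Finset.card_sdiff_add_card_eq_card (Finset.mem_powerset.1 hA)
          have h2 : (A.card = a ∧ (S \ A).card = 1) ↔ (A.card = a ∧ S.card = a + 1) := by
            omega
          simp only [true_and, one_mul, ← h2, ite_and]
          split_ifs <;> simp
        · intro C _ hC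
          simp [Ne.symm hC]
      rw [Finset.sum_congr rfl step]
      by_cases hS : S.card = a + 1
      · simp only [hS, and_true, true_and, if_true]
        rw [← Finset.sum_filter, ← Finset.powersetCard_eq_filter, Finset.sum_const,
          Finset.card_powersetCard, hS, Nat.choose_succ_self_right, Nat.factorial_succ]
        simp
      · simp [hS]
    · rw [if_neg (fun h => hST h.1)]
      refine Finset.sum_eq_zero fun A hA => Finset.sum_eq_zero fun C hC => ?_
      by_cases h1 : A = C
      · by_cases h2 : S \ A = T \ C
        · exfalso
          apply hST
          rw [← Finset.sdiff_union_of_subset (Finset.mem_powerset.1 hA),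
            ← Finset.sdiff_union_of_subset (Finset.mem_powerset.1 hC), h2, h1]
        · simp [h2]
      · simp [h1]

/-- The summand attached to a quadruple. -/
noncomputable def term (θ ω : DF n) (R Q X Y : Finset (Fin n)) : ℝ :=
  DF.shuffleSign R X * DF.shuffleSign R Y * DF.shuffleSign Q X * DF.shuffleSign Q Y *
    (-1 : ℝ) ^ X.card * θ (R ∪ X) (R ∪ Y) * ω (Q ∪ X) (Q ∪ Y)

/-- The disjointness condition on quadruples. -/
def Good (R Q X Y : Finset (Fin n)) : Prop :=
  Disjoint R X ∧ Disjoint R Y ∧ Disjoint Q X ∧ Disjoint Q Y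

instance (R Q X Y : Finset (Fin n)) : Decidable (Good R Q X Y) := by
  unfold Good; infer_instance

theorem dinner_mul (a : ℕ) (x ω : DF n) :
    DF.dinner (DF.mul (DF.pow (DF.gm n) a) x) ω =
      (a.factorial : ℝ) * ∑ Q : Finset (Fin n), ∑ X : Finset (Fin n), ∑ Y : Finset (Fin n),
        if Q.card = a ∧ Disjoint Q X ∧ Disjoint Q Y then
          DF.shuffleSign Q X * DF.shuffleSign Q Y * x X Y * ω (Q ∪ X) (Q ∪ Y) else 0 := by
  unfold DF.dinner DF.mul
  simp only [Finset.sum_mul]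
  have h1 : ∀ S : Finset (Fin n), (∑ T : Finset (Fin n), ∑ A ∈ S.powerset, ∑ C ∈ T.powerset,
      DF.shuffleSign A (S \ A) * DF.shuffleSign C (T \ C) * DF.pow (DF.gm n) a A C *
        x (S \ A) (T \ C) * ω S T) = ∑ A ∈ S.powerset, ∑ Y : Finset (Fin n),
        if Disjoint A Y ∧ A.card = a then
          (a.factorial : ℝ) * (DF.shuffleSign A (S \ A) * DF.shuffleSign A Y *
           x (S \ A) Y * ω S (A ∪ Y)) else 0 := by
    intro S
    rw [Finset.sum_comm]
    refine Finset.sum_congr rfl fun A _ => ?_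
    rw [sum_powerset_reindex (fun C D T => DF.shuffleSign A (S \ A) * DF.shuffleSign C D *
      DF.pow (DF.gm n) a A C * x (S \ A) D * ω S T)]
    rw [Finset.sum_eq_single A]
    · refine Finset.sum_congr rfl fun Y _ => ?_
      rw [pow_gm_eq]
      by_cases h : Disjoint A Y <;> by_cases h' : A.card = a <;> simp [h, h']
      ring
    · intro C _ hC
      simp [pow_gm_eq, Ne.symm hC]
    · simp
  rw [Finset.sum_congr rfl fun S _ => h1 S,
    sum_powerset_reindex (fun A X S => ∑ Y : Finset (Fin n),
        if Disjoint A Y ∧ A.card = a then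
          (a.factorial : ℝ) * (DF.shuffleSign A X * DF.shuffleSign A Y *
           x X Y * ω S (A ∪ Y)) else 0), Finset.mul_sum]
  refine Finset.sum_congr rfl fun Q _ => ?_
  rw [Finset.mul_sum]
  refine Finset.sum_congr rfl fun X _ => ?_
  rw [Finset.mul_sum]
  by_cases h : Disjoint Q X
  · rw [if_pos h]
    refine Finset.sum_congr rfl fun Y _ => ?_
    by_cases h2 : Disjoint Q Y <;> by_cases h' : Q.card = a <;> simp [h, h2, h']
  · simp [h]

theorem dinner_contr (a r : ℕ) (θ ω : DF n) :
    DF.dinner (DF.mul (DF.pow (DF.gm n) a) (DF.contrN r θ)) ω =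
      ((a.factorial * r.factorial : ℕ) : ℝ) *
      ∑ R : Finset (Fin n), ∑ Q : Finset (Fin n), ∑ X : Finset (Fin n), ∑ Y : Finset (Fin n),
        if Good R Q X Y ∧ Q.card = a ∧ R.card = r then
          (-1 : ℝ) ^ X.card * term θ ω R Q X Y else 0 := by
  rw [dinner_mul]
  push_cast
  rw [mul_assoc]
  congr 1
  conv_rhs => rw [Finset.sum_comm, Finset.mul_sum]
  refine Finset.sum_congr rfl fun Q _ => ?_
  conv_rhs => rw [Finset.sum_comm, Finset.mul_sum]
  refine Finset.sum_congr rfl fun X _ => ?_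
  conv_rhs => rw [Finset.sum_comm, Finset.mul_sum]
  refine Finset.sum_congr rfl fun Y _ => ?_
  rw [contrN_eq]
  by_cases h : Q.card = a ∧ Disjoint Q X ∧ Disjoint Q Y
  · rw [if_pos h, Finset.mul_sum, Finset.mul_sum, Finset.mul_sum, Finset.sum_mul]
    refine Finset.sum_congr rfl fun R _ => ?_
    unfold Good
    by_cases h2 : R.card = r ∧ Disjoint R X ∧ Disjoint R Y
    · rw [if_pos h2, if_pos (by tauto)]
      unfold term
      have : (-1 : ℝ) ^ X.card * (-1 : ℝ) ^ X.card = 1 := by rw [← mul_pow]; simp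
      linear_combination (-((r.factorial : ℝ)) * (DF.shuffleSign R X * DF.shuffleSign R Y *
        DF.shuffleSign Q X * DF.shuffleSign Q Y * θ (R ∪ X) (R ∪ Y) * ω (Q ∪ X) (Q ∪ Y))) * this
    · rw [if_neg h2, if_neg (by tauto)]
      simp
  · rw [if_neg h, Finset.sum_eq_zero, mul_zero]
    intro R _
    rw [if_neg]
    unfold Good
    tauto

theorem term_toggle (θ ω : DF n) {i : Fin n} {R Q X Y : Finset (Fin n)}
    (hR : i ∉ R) (hQ : i ∉ Q) (hX : i ∉ X) (hY : i ∉ Y) :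
    term θ ω (insert i R) (insert i Q) X Y + term θ ω R Q (insert i X) (insert i Y) = 0 := by
  unfold term
  simp only [sgn_insert_left _ hR, sgn_insert_left _ hQ, sgn_insert_right _ hX,
    sgn_insert_right _ hY, Finset.union_insert, Finset.insert_union,
    Finset.card_insert_of_notMem hX]
  have h1 := sgn_sq {i} X
  have h2 := sgn_sq {i} Y
  have h3 := sgn_sq R {i}
  have h4 := sgn_sq Q {i}
  generalize θ _ _ = t
  generalize ω _ _ = w
  generalize DF.shuffleSign {i} X = a at *
  generalize DF.shuffleSign {i} Y = b at *
  generalize DF.shuffleSign R {i} = c at *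
  generalize DF.shuffleSign Q {i} = d at *
  generalize DF.shuffleSign R X = e1
  generalize DF.shuffleSign R Y = e2
  generalize DF.shuffleSign Q X = e3
  generalize DF.shuffleSign Q Y = e4
  have e : (a * a) * (b * b) - (c * c) * (d * d) = 0 := by rw [h1, h2, h3, h4]; ring
  rw [pow_succ]
  linear_combination (e1 * e2 * e3 * e4 * t * w * (-1) ^ X.card) * e

abbrev Quad (n : ℕ) := Finset (Fin n) × Finset (Fin n) × Finset (Fin n) × Finset (Fin n)

def kset (q : Quad n) : Finset (Fin n) := (q.1 ∩ q.2.1) ∪ (q.2.2.1 ∩ q.2.2.2)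

def tog (i : Fin n) (q : Quad n) : Quad n :=
  (symmDiff q.1 {i}, symmDiff q.2.1 {i}, symmDiff q.2.2.1 {i}, symmDiff q.2.2.2 {i})

theorem tog_tog (i : Fin n) (q : Quad n) : tog i (tog i q) = q := by
  simp [tog]

theorem symmDiff_of_mem {i : Fin n} {A : Finset (Fin n)} (h : i ∈ A) :
    symmDiff A {i} = A.erase i := by
  ext x; simp only [Finset.mem_symmDiff, Finset.mem_singleton, Finset.mem_erase]
  by_cases hx : x = i
  · subst hx; simp [h]
  · simp [hx]

theorem symmDiff_of_notMem {i : Fin n} {A : Finset (Fin n)} (h : i ∉ A) :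
    symmDiff A {i} = insert i A := by
  ext x; simp only [Finset.mem_symmDiff, Finset.mem_singleton, Finset.mem_insert]
  by_cases hx : x = i
  · subst hx; simp [h]
  · simp [hx]

theorem good_cases {i : Fin n} {R Q X Y : Finset (Fin n)} (hg : Good R Q X Y)
    (hi : i ∈ kset (R, Q, X, Y)) :
    (i ∈ R ∧ i ∈ Q ∧ i ∉ X ∧ i ∉ Y) ∨ (i ∉ R ∧ i ∉ Q ∧ i ∈ X ∧ i ∈ Y) := by
  obtain ⟨h1, h2, h3, h4⟩ := hg
  simp only [Finset.disjoint_left] at h1 h2 h3 h4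
  have a1 := @h1 i
  have a2 := @h2 i
  have a3 := @h3 i
  have a4 := @h4 i
  simp only [kset, Finset.mem_union, Finset.mem_inter] at hi
  tauto

theorem good_tog {i : Fin n} {R Q X Y : Finset (Fin n)} (hg : Good R Q X Y)
    (hi : i ∈ kset (R, Q, X, Y)) :
    Good (symmDiff R {i}) (symmDiff Q {i}) (symmDiff X {i}) (symmDiff Y {i}) := by
  have hc := good_cases hg hi
  obtain ⟨h1, h2, h3, h4⟩ := hg
  simp only [Finset.disjoint_left] at h1 h2 h3 h4
  refine ⟨?_, ?_, ?_, ?_⟩ <;>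
  · rw [Finset.disjoint_left]
    intro x
    have a1 := @h1 x
    have a2 := @h2 x
    have a3 := @h3 x
    have a4 := @h4 x
    simp only [Finset.mem_symmDiff, Finset.mem_singleton]
    by_cases hx : x = i
    · subst hx; tauto
    · simp only [hx]; tauto

theorem kset_tog {i : Fin n} {R Q X Y : Finset (Fin n)} (hg : Good R Q X Y)
    (hi : i ∈ kset (R, Q, X, Y)) :
    kset (tog i (R, Q, X, Y)) = kset (R, Q, X, Y) := by
  have hc := good_cases hg hi
  ext x
  simp only [kset, tog, Finset.mem_union, Finset.mem_inter, Finset.mem_symmDiff,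
    Finset.mem_singleton]
  by_cases hx : x = i
  · subst hx; tauto
  · simp only [hx]; tauto

theorem term_tog (θ ω : DF n) {i : Fin n} {R Q X Y : Finset (Fin n)} (hg : Good R Q X Y)
    (hi : i ∈ kset (R, Q, X, Y)) :
    term θ ω R Q X Y + term θ ω (symmDiff R {i}) (symmDiff Q {i}) (symmDiff X {i})
      (symmDiff Y {i}) = 0 := by
  rcases good_cases hg hi with ⟨h1, h2, h3, h4⟩ | ⟨h1, h2, h3, h4⟩
  · rw [symmDiff_of_mem h1, symmDiff_of_mem h2, symmDiff_of_notMem h3, symmDiff_of_notMem h4]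
    have := term_toggle θ ω (Finset.notMem_erase i R) (Finset.notMem_erase i Q) h3 h4
    rwa [Finset.insert_erase h1, Finset.insert_erase h2] at this
  · rw [symmDiff_of_mem h3, symmDiff_of_mem h4, symmDiff_of_notMem h1, symmDiff_of_notMem h2]
    have := term_toggle θ ω h1 h2 (Finset.notMem_erase i X) (Finset.notMem_erase i Y)
    rw [Finset.insert_erase h3, Finset.insert_erase h4] at this
    rw [add_comm]; exact this

theorem sum_bad (θ ω : DF n) :
    ∑ q ∈ (Finset.univ : Finset (Quad n)).filter
        (fun q => Good q.1 q.2.1 q.2.2.1 q.2.2.2 ∧ (kset q).Nonempty),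
      term θ ω q.1 q.2.1 q.2.2.1 q.2.2.2 = 0 := by
  refine Finset.sum_involution
    (fun q hq => tog ((kset q).min' (Finset.mem_filter.1 hq).2.2) q) ?_ ?_ ?_ ?_
  · rintro ⟨R, Q, X, Y⟩ hq
    exact term_tog θ ω (Finset.mem_filter.1 hq).2.1 (Finset.min'_mem _ _)
  · rintro ⟨R, Q, X, Y⟩ hq _ he
    have hh := congrArg Prod.fst he
    simp [tog] at hh
  · rintro ⟨R, Q, X, Y⟩ hq
    have hg := (Finset.mem_filter.1 hq).2.1
    have hne := (Finset.mem_filter.1 hq).2.2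
    refine Finset.mem_filter.2 ⟨Finset.mem_univ _, good_tog hg (Finset.min'_mem _ hne), ?_⟩
    rw [kset_tog hg (Finset.min'_mem _ hne)]
    exact hne
  · rintro ⟨R, Q, X, Y⟩ hq
    have hg := (Finset.mem_filter.1 hq).2.1
    have hne := (Finset.mem_filter.1 hq).2.2
    have hk := kset_tog hg (Finset.min'_mem _ hne)
    simp only [hk, tog_tog]

theorem sum_quad (m : ℕ) (θ ω : DF n) (hθ : DF.IsDeg m θ) (hω : DF.IsSymm ω) :
    (∑ q ∈ (Finset.univ : Finset (Quad n)).filter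
        (fun q => Good q.1 q.2.1 q.2.2.1 q.2.2.2),
      term θ ω q.1 q.2.1 q.2.2.1 q.2.2.2) = ∑ S : Finset (Fin n), DF.mul θ ω S S := by
  rw [← Finset.sum_filter_add_sum_filter_not _ (fun q => (kset q).Nonempty),
    Finset.filter_filter, sum_bad, zero_add, Finset.filter_filter]
  unfold DF.mul
  simp only [← Finset.sum_product']
  rw [Finset.sum_sigma']
  refine Finset.sum_nbij'
    (fun q => ⟨q.1 ∪ q.2.1 ∪ q.2.2.1 ∪ q.2.2.2, (q.1 ∪ q.2.2.1, q.1 ∪ q.2.2.2)⟩)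
    (fun x => (x.2.1 ∩ x.2.2, x.1 \ (x.2.1 ∪ x.2.2), x.2.1 \ x.2.2, x.2.2 \ x.2.1))
    ?_ ?_ ?_ ?_ ?_
  · rintro ⟨R, Q, X, Y⟩ _
    simp only [Finset.mem_sigma, Finset.mem_univ, Finset.mem_product, Finset.mem_powerset,
      true_and]
    constructor <;> intro x <;> simp only [Finset.mem_union] <;> tauto
  · rintro ⟨S, A, C⟩ h
    simp only [Finset.mem_sigma, Finset.mem_univ, Finset.mem_product, Finset.mem_powerset,
      true_and] at h
    simp only [Finset.mem_filter, Finset.mem_univ, true_and, Good, kset,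
      Finset.not_nonempty_iff_eq_empty, Finset.disjoint_left, Finset.eq_empty_iff_forall_notMem]
    refine ⟨⟨?_, ?_, ?_, ?_⟩, ?_⟩ <;> intro x <;>
      simp only [Finset.mem_union, Finset.mem_inter, Finset.mem_sdiff] <;> tauto
  · rintro ⟨R, Q, X, Y⟩ h
    simp only [Finset.mem_filter, Finset.mem_univ, true_and, Good, kset,
      Finset.not_nonempty_iff_eq_empty, Finset.disjoint_left,
      Finset.eq_empty_iff_forall_notMem, Finset.mem_union, Finset.mem_inter] at h
    obtain ⟨⟨h1, h2, h3, h4⟩, h5⟩ := h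
    simp only [Prod.mk.injEq]
    refine ⟨?_, ?_, ?_, ?_⟩ <;> ext x <;>
      simp only [Finset.mem_union, Finset.mem_inter, Finset.mem_sdiff] <;>
      have a1 := @h1 x <;> have a2 := @h2 x <;> have a3 := @h3 x <;> have a4 := @h4 x <;>
      have a5 := h5 x <;> clear h1 h2 h3 h4 h5 <;> grind
  · rintro ⟨S, A, C⟩ h
    simp only [Finset.mem_sigma, Finset.mem_univ, Finset.mem_product, Finset.mem_powerset,
      true_and] at h
    obtain ⟨hA, hC⟩ := h
    have e1 : (A ∩ C) ∪ (A \ C) = A := by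
      ext x; simp only [Finset.mem_union, Finset.mem_inter, Finset.mem_sdiff]; tauto
    have e2 : (A ∩ C) ∪ (C \ A) = C := by
      ext x; simp only [Finset.mem_union, Finset.mem_inter, Finset.mem_sdiff]; tauto
    have e3 : (A ∩ C) ∪ (S \ (A ∪ C)) ∪ (A \ C) ∪ (C \ A) = S := by
      ext x; simp only [Finset.mem_union, Finset.mem_inter, Finset.mem_sdiff]
      have := @hA x
      have := @hC x
      tauto
    simp only [e1, e2, e3]
  · rintro ⟨R, Q, X, Y⟩ h
    simp only [Finset.mem_filter, Finset.mem_univ, true_and, Good, kset,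
      Finset.not_nonempty_iff_eq_empty, Finset.union_eq_empty,
      ← Finset.disjoint_iff_inter_eq_empty] at h
    obtain ⟨⟨h1, h2, h3, h4⟩, h5, h6⟩ := h
    have k1 : (R ∪ Q ∪ X ∪ Y) \ (R ∪ X) = Q ∪ Y := by
      simp only [Finset.disjoint_left] at h1 h2 h3 h4 h5 h6
      ext x
      have a1 := @h1 x
      have a2 := @h2 x
      have a3 := @h3 x
      have a4 := @h4 x
      have a5 := @h5 x
      have a6 := @h6 x
      simp only [Finset.mem_union, Finset.mem_sdiff]
      clear h1 h2 h3 h4 h5 h6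
      grind
    have k2 : (R ∪ Q ∪ X ∪ Y) \ (R ∪ Y) = Q ∪ X := by
      simp only [Finset.disjoint_left] at h1 h2 h3 h4 h5 h6
      ext x
      have a1 := @h1 x
      have a2 := @h2 x
      have a3 := @h3 x
      have a4 := @h4 x
      have a5 := @h5 x
      have a6 := @h6 x
      simp only [Finset.mem_union, Finset.mem_sdiff]
      clear h1 h2 h3 h4 h5 h6
      grind
    simp only [k1, k2]
    unfold term
    by_cases hz : θ (R ∪ X) (R ∪ Y) = 0
    · simp [hz]
    obtain ⟨c1, c2⟩ := hθ _ _ hz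
    rw [Finset.card_union_of_disjoint h1] at c1
    rw [Finset.card_union_of_disjoint h2] at c2
    have hXY : Y.card = X.card := by omega
    rw [sgn_union_left _ h1, sgn_union_left _ h2, sgn_union_right _ h4, sgn_union_right _ h4,
      sgn_union_right _ h3, sgn_union_right _ h3, hω (Q ∪ Y) (Q ∪ X),
      sgn_swap h3.symm, sgn_swap h4.symm, sgn_swap h6.symm, hXY]
    have s1 := sgn_sq R Q
    have s2 := sgn_sq X Y
    have s3 : ((-1 : ℝ) ^ (X.card * Q.card)) * ((-1 : ℝ) ^ (X.card * Q.card)) = 1 := by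
      rw [← mul_pow]; simp
    have s4 : ((-1 : ℝ) ^ (X.card * X.card)) = (-1 : ℝ) ^ X.card := by
      rcases Nat.even_or_odd X.card with hh | hh
      · rw [hh.neg_one_pow, (hh.mul_right _).neg_one_pow]
      · rw [hh.neg_one_pow, (hh.mul hh).neg_one_pow]
    rw [s4]
    generalize θ _ _ = t
    generalize ω _ _ = w
    generalize DF.shuffleSign R Q = u1 at *
    generalize DF.shuffleSign X Y = u2 at *
    generalize (-1 : ℝ) ^ (X.card * Q.card) = u3 at *
    generalize (-1 : ℝ) ^ X.card = u4
    generalize DF.shuffleSign R X = e1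
    generalize DF.shuffleSign R Y = e2
    generalize DF.shuffleSign Q X = e3
    generalize DF.shuffleSign Q Y = e4
    have e : (u1 * u1) * (u2 * u2) * (u3 * u3) = 1 := by rw [s1, s2, s3]; ring
    linear_combination (-(e1 * e2 * e3 * e4 * t * w * u4)) * e

theorem isDeg_mul {a b : ℕ} {θ ω : DF n} (hθ : DF.IsDeg a θ) (hω : DF.IsDeg b ω) :
    DF.IsDeg (a + b) (DF.mul θ ω) := by
  intro S T h
  obtain ⟨A, hA, h⟩ := Finset.exists_ne_zero_of_sum_ne_zero h
  obtain ⟨C, hC, h⟩ := Finset.exists_ne_zero_of_sum_ne_zero h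
  have h1 := hθ A C (by intro h0; simp [h0] at h)
  have h2 := hω (S \ A) (T \ C) (by intro h0; simp [h0] at h)
  have h3 := Finset.card_sdiff_add_card_eq_card (Finset.mem_powerset.1 hA)
  have h4 := Finset.card_sdiff_add_card_eq_card (Finset.mem_powerset.1 hC)
  omega

theorem isDeg_pow {p : ℕ} {ω : DF n} (hω : DF.IsDeg p ω) (k : ℕ) :
    DF.IsDeg (p * k) (DF.pow ω k) := by
  induction k with
  | zero =>
    intro S T h
    simp only [DF.pow, DF.one] at h
    have : S = ∅ ∧ T = ∅ := by
      by_contra h0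
      simp [h0] at h
    simp [this]
  | succ k ih => exact isDeg_mul ih hω

theorem full_contr {N : ℕ} {ψ : DF n} (h : DF.IsDeg N ψ) :
    DF.toScalar (DF.contrN N ψ) = (N.factorial : ℝ) * ∑ S : Finset (Fin n), ψ S S := by
  unfold DF.toScalar
  rw [contrN_eq]
  congr 1
  refine Finset.sum_congr rfl fun R _ => ?_
  simp only [Finset.disjoint_empty_right, and_true, sgn_empty_right, Finset.union_empty, one_mul]
  split_ifs with hR
  · rfl
  · by_contra h0
    exact hR (h R R (Ne.symm h0)).1

theorem dinner_sum_left (s : Finset ℕ) (f : ℕ → DF n) (ω : DF n) :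
    DF.dinner (∑ r ∈ s, f r) ω = ∑ r ∈ s, DF.dinner (f r) ω := by
  unfold DF.dinner
  simp only [Finset.sum_apply, Finset.sum_mul]
  rw [Finset.sum_comm]
  rw [Finset.sum_comm]
  conv_rhs => rw [Finset.sum_comm]
  refine Finset.sum_congr rfl fun S _ => ?_
  rw [Finset.sum_comm]

theorem dinner_smul_left (a : ℝ) (θ ω : DF n) :
    DF.dinner (a • θ) ω = a * DF.dinner θ ω := by
  unfold DF.dinner
  simp only [Pi.smul_apply, smul_eq_mul, Finset.mul_sum, mul_assoc]

theorem main_aux (m p : ℕ) (hmp : p ≤ m) (θ ω : DF n) (hθ : DF.IsDeg m θ) (hω : DF.IsDeg p ω)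
    (hs : DF.IsSymm ω) :
    DF.dinner
      (∑ r ∈ Finset.Icc (m - p) m,
        (-1 : ℝ) ^ (r + m) •
          ((((p + r - m).factorial * r.factorial : ℕ) : ℝ)⁻¹ •
            DF.mul (DF.pow (DF.gm n) (p + r - m)) (DF.contrN r θ))) ω
      = DF.toScalar (DF.contrN (m + p) (DF.mul θ ω)) / (((m + p).factorial : ℕ) : ℝ) := by
  rw [full_contr (isDeg_mul hθ hω), mul_div_cancel_left₀ _ (by positivity),
    ← sum_quad m θ ω hθ hs, dinner_sum_left]
  have h1 : ∀ r ∈ Finset.Icc (m - p) m, DF.dinner ((-1 : ℝ) ^ (r + m) •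
          ((((p + r - m).factorial * r.factorial : ℕ) : ℝ)⁻¹ •
            DF.mul (DF.pow (DF.gm n) (p + r - m)) (DF.contrN r θ))) ω
      = ∑ q : Quad n, if Good q.1 q.2.1 q.2.2.1 q.2.2.2 then
          (if q.1.card = r then term θ ω q.1 q.2.1 q.2.2.1 q.2.2.2 else 0) else 0 := by
    intro r hr
    rw [Finset.mem_Icc] at hr
    rw [dinner_smul_left, dinner_smul_left, dinner_contr, inv_mul_cancel_left₀ (by positivity)]
    simp only [← Finset.univ_product_univ, Finset.sum_product]
    simp only [Finset.mul_sum]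
    refine Finset.sum_congr rfl fun R _ => Finset.sum_congr rfl fun Q _ =>
      Finset.sum_congr rfl fun X _ => Finset.sum_congr rfl fun Y _ => ?_
    by_cases hg : Good R Q X Y
    swap
    · simp [hg]
    by_cases hR : R.card = r
    swap
    · simp [hR]
    simp only [hg, hR, and_true, true_and, if_true]
    by_cases hz : term θ ω R Q X Y = 0
    · simp [hz]
    obtain ⟨g1, g2, g3, g4⟩ := hg
    have d1 := hθ (R ∪ X) (R ∪ Y) (by intro h0; simp [term, h0] at hz)
    have d2 := hω (Q ∪ X) (Q ∪ Y) (by intro h0; simp [term, h0] at hz)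
    rw [Finset.card_union_of_disjoint g1, Finset.card_union_of_disjoint g2] at d1
    rw [Finset.card_union_of_disjoint g3, Finset.card_union_of_disjoint g4] at d2
    rw [if_pos (by omega), ← mul_assoc, ← pow_add, Even.neg_one_pow, one_mul]
    exact ⟨m, by omega⟩
  rw [Finset.sum_congr rfl h1, Finset.sum_comm, Finset.sum_filter]
  refine Finset.sum_congr rfl ?_
  rintro ⟨R, Q, X, Y⟩ _
  by_cases hg : Good R Q X Y
  swap
  · simp [hg]
  simp only [hg, if_true]
  by_cases hz : term θ ω R Q X Y = 0
  · simp [hz]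
  rw [Finset.sum_ite_eq, if_pos]
  obtain ⟨g1, g2, g3, g4⟩ := hg
  have d1 := hθ (R ∪ X) (R ∪ Y) (by intro h0; simp [term, h0] at hz)
  have d2 := hω (Q ∪ X) (Q ∪ Y) (by intro h0; simp [term, h0] at hz)
  rw [Finset.card_union_of_disjoint g1, Finset.card_union_of_disjoint g2] at d1
  rw [Finset.card_union_of_disjoint g3, Finset.card_union_of_disjoint g4] at d2
  rw [Finset.mem_Icc]
  omega

theorem isDeg_ofForm {V : Type*} [NormedAddCommGroup V] [InnerProductSpace ℝ V]
    (e : OrthonormalBasis (Fin n) ℝ V) (p : ℕ) (ω : (Fin p → V) → (Fin p → V) → ℝ) :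
    DF.IsDeg p (ofForm e p ω) := by
  intro S T h
  by_contra h0
  simp [ofForm, h0] at h

theorem isSymm_ofForm {V : Type*} [NormedAddCommGroup V] [InnerProductSpace ℝ V]
    (e : OrthonormalBasis (Fin n) ℝ V) (p : ℕ) (ω : (Fin p → V) → (Fin p → V) → ℝ)
    (h : IsSymmForm p ω) : DF.IsSymm (ofForm e p ω) := by
  intro S T
  unfold ofForm
  by_cases h0 : S.card = p ∧ T.card = p
  · rw [dif_pos h0, dif_pos h0.symm, h]
  · rw [dif_neg h0, dif_neg (fun h1 => h0 h1.symm)]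

end NewtonAux

/-- **generalized Newton trace formula.** For a symmetric `(p,p)`-double
form `ω` satisfying the first Bianchi identity, with `p, k ≥ 1` and `p(k+1) ≤ n`,
`⟨ ∑_{r=pk−p}^{pk} (−1)^{r+pk} g^{p−pk+r} c^r(ω^k) / ((p−pk+r)!·r!) , ω ⟩
  = c^{pk+p}(ω^{k+1}) / (pk+p)!`. -/
theorem stmt3_generalized_newton_trace_formula
    (n p k : ℕ) (hp : 1 ≤ p) (hk : 1 ≤ k) (hpk : p * (k + 1) ≤ n)
    (V : Type*) [NormedAddCommGroup V] [InnerProductSpace ℝ V]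
    (hV : Module.finrank ℝ V = n)
    (e : OrthonormalBasis (Fin n) ℝ V)
    (ω : (Fin p → V) → (Fin p → V) → ℝ)
    (hω : IsDoubleForm p ω) (hsymm : IsSymmForm p ω)
    (hbianchi : FirstBianchiForm p hp ω) :
    DF.dinner
      (∑ r ∈ Finset.Icc (p * k - p) (p * k),
        (-1 : ℝ) ^ (r + p * k) •
          ((((p + r - p * k).factorial * r.factorial : ℕ) : ℝ)⁻¹ •
            DF.mul (DF.pow (DF.gm n) (p + r - p * k))
              (DF.contrN r (DF.pow (ofForm e p ω) k))))
      (ofForm e p ω)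
      = DF.toScalar (DF.contrN (p * k + p) (DF.pow (ofForm e p ω) (k + 1))) /
          (((p * k + p).factorial : ℕ) : ℝ) := by
  exact NewtonAux.main_aux (p * k) p (Nat.le_mul_of_pos_right p hk) _ _
    (NewtonAux.isDeg_pow (NewtonAux.isDeg_ofForm e p ω) k)
    (NewtonAux.isDeg_ofForm e p ω) (NewtonAux.isSymm_ofForm e p ω hsymm)
end

section
/- Avez-type formula for higher Gauss–Bonnet curvatures: let R be an algebraic curvature tensor on an n-dimensional real inner product space (V,g) and let k ≥ 1 be an integer with 2k+2 ≤ n. Then h_{2k+2} = ⟨ c^{2k−2}R^k/(2k−2)! , R ⟩ − ⟨ c^{2k−1}R^k/(2k−1)! , cR ⟩ + h_{2k}·h_2. -/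
/-!
Double forms on an `n`-dimensional real inner product space `(V, g)`, represented
by their components with respect to a (fixed) orthonormal basis: a `(p,q)`-double
form is determined by its values on pairs of increasingly ordered tuples of
distinct basis vectors, i.e. by a function `Finset (Fin n) → Finset (Fin n) → ℝ`
(supported on pairs of sets of cardinalities `p` and `q`).
-/

open Finset

namespace Avez

open DF

variable {n : ℕ}

/-- Reindexing of a sum over sets through `E ↦ insert i E`. -/
lemma sum_insert_reindex (i : Fin n) (H : Finset (Fin n) → ℝ) :
    ∑ E : Finset (Fin n), (if i ∈ E then 0 else H (insert i E)) =
      ∑ F : Finset (Fin n), if i ∈ F then H F else 0 := by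
  have h1 : ∀ E : Finset (Fin n), (if i ∈ E then 0 else H (insert i E)) =
      if i ∉ E then H (insert i E) else 0 := by
    intro E; by_cases h : i ∈ E <;> simp [h]
  simp only [h1]
  rw [← Finset.sum_filter, ← Finset.sum_filter]
  refine Finset.sum_bij' (fun E _ => insert i E) (fun F _ => F.erase i) ?_ ?_ ?_ ?_ ?_
  · intro E _; simp
  · intro F _; simp
  · intro E hE; simp at hE; exact Finset.erase_insert hE
  · intro F hF; simp at hF; exact Finset.insert_erase hF
  · intro E _; rfl

/-- Removing one element from the set to be avoided. -/
lemma sum_disjoint_split (l : Fin n) (U : Finset (Fin n)) (hl : l ∉ U)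
    (F : Finset (Fin n) → ℝ) :
    ∑ E : Finset (Fin n), (if Disjoint E U then F E else 0) =
      ∑ E : Finset (Fin n), (if Disjoint E (insert l U) then F E + F (insert l E) else 0) := by
  have h2 := sum_insert_reindex l (fun E => if Disjoint E U then F E else 0)
  have h3 : ∑ E : Finset (Fin n), (if Disjoint E U then F E else 0) =
      ∑ E : Finset (Fin n), (if l ∈ E then 0 else (if Disjoint E U then F E else 0)) +
      ∑ E : Finset (Fin n), (if l ∈ E then (if Disjoint E U then F E else 0) else 0) := by
    rw [← Finset.sum_add_distrib]
    refine Finset.sum_congr rfl fun E _ => ?_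
    by_cases h : l ∈ E <;> simp [h]
  rw [h3, ← h2, ← Finset.sum_add_distrib]
  refine Finset.sum_congr rfl fun E _ => ?_
  by_cases h : l ∈ E <;> by_cases h' : Disjoint E U <;>
    simp [h, h', hl, Finset.disjoint_insert_left, Finset.disjoint_insert_right]

lemma sgn_union_left (A A' B : Finset (Fin n)) (h : Disjoint A A') :
    shuffleSign (A ∪ A') B = shuffleSign A B * shuffleSign A' B := by
  unfold shuffleSign
  rw [Finset.sum_union h, pow_add]

lemma sgn_union_right (A B B' : Finset (Fin n)) (h : Disjoint B B') :
    shuffleSign A (B ∪ B') = shuffleSign A B * shuffleSign A B' := by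
  unfold shuffleSign
  rw [← pow_add, ← Finset.sum_add_distrib]
  congr 1
  refine Finset.sum_congr rfl fun a _ => ?_
  rw [Finset.filter_union, Finset.card_union_of_disjoint]
  exact Finset.disjoint_filter_filter h

lemma sgn_insert_left (i : Fin n) (A B : Finset (Fin n)) (h : i ∉ A) :
    shuffleSign (insert i A) B = shuffleSign {i} B * shuffleSign A B := by
  rw [Finset.insert_eq, sgn_union_left]; simpa using h

lemma sgn_insert_right (i : Fin n) (A B : Finset (Fin n)) (h : i ∉ B) :
    shuffleSign A (insert i B) = shuffleSign A {i} * shuffleSign A B := by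
  rw [Finset.insert_eq, sgn_union_right]; simpa using h

lemma sgn_mul_self (A B : Finset (Fin n)) : shuffleSign A B * shuffleSign A B = 1 := by
  unfold shuffleSign
  rw [← mul_pow]; simp

lemma sgn_swap (i j : Fin n) (h : i ≠ j) : shuffleSign {i} {j} = - shuffleSign {j} {i} := by
  unfold shuffleSign
  rcases lt_or_gt_of_ne h with h' | h' <;>
    simp [Finset.filter_singleton, h', not_lt_of_gt h']

@[simp] lemma sgn_empty_right (A : Finset (Fin n)) : shuffleSign A ∅ = 1 := by
  simp [shuffleSign]

@[simp] lemma sgn_empty_left (A : Finset (Fin n)) : shuffleSign ∅ A = 1 := by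
  simp [shuffleSign]

/-- Closed form of the iterated contraction. -/
lemma contrN_eq (P : DF n) (r : ℕ) : ∀ A B : Finset (Fin n), contrN r P A B =
    (r.factorial : ℝ) * ∑ E : Finset (Fin n), if E.card = r ∧ Disjoint E A ∧ Disjoint E B then
      shuffleSign E A * shuffleSign E B * P (A ∪ E) (B ∪ E) else 0 := by
  induction r with
  | zero =>
    intro A B
    rw [Finset.sum_eq_single ∅]
    · simp [contrN]
    · intro E _ hE; simp [hE]
    · simp
  | succ r ih =>
    intro A B
    have h0 : contrN (r + 1) P = contr (contrN r P) := by
      unfold contrN; rw [Function.iterate_succ_apply']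
    rw [h0]
    unfold contr
    set G : Finset (Fin n) → ℝ := fun E =>
      if E.card = r + 1 ∧ Disjoint E A ∧ Disjoint E B then
      shuffleSign E A * shuffleSign E B * P (A ∪ E) (B ∪ E) else 0 with hG
    have key : ∀ i : Fin n, (if i ∈ A ∨ i ∈ B then 0
        else shuffleSign {i} A * shuffleSign {i} B * contrN r P (insert i A) (insert i B)) =
        (r.factorial : ℝ) * ∑ F : Finset (Fin n), if i ∈ F then G F else 0 := by
      intro i
      rw [← sum_insert_reindex i G]
      split_ifs with h
      · symm
        rw [mul_eq_zero]; right
        refine Finset.sum_eq_zero fun E _ => ?_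
        split_ifs with hE
        · rfl
        · simp only [hG]
          rw [if_neg]
          rintro ⟨_, h1, h2⟩
          rw [Finset.disjoint_insert_left] at h1 h2
          tauto
      · rw [ih, mul_left_comm]
        congr 1
        rw [Finset.mul_sum]
        refine Finset.sum_congr rfl fun E _ => ?_
        push Not at h
        by_cases hE : i ∈ E
        · simp [hE]
        · simp only [hE, hG, Finset.disjoint_insert_left, Finset.disjoint_insert_right,
            Finset.card_insert_of_notMem hE, h.1, h.2, not_false_eq_true, true_and, if_false,
            add_left_inj]
          split_ifs with hc
          · rw [sgn_insert_left i E A hE, sgn_insert_left i E B hE, sgn_insert_right i E A h.1,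
              sgn_insert_right i E B h.2]
            rw [Finset.insert_union, Finset.insert_union, Finset.union_insert, Finset.union_insert]
            linear_combination (shuffleSign {i} A * shuffleSign {i} B * shuffleSign E A *
              shuffleSign E B * P (insert i (A ∪ E)) (insert i (B ∪ E))) *
              sgn_mul_self E {i}
          · ring
    rw [Finset.sum_congr rfl fun i _ => key i, ← Finset.mul_sum, Finset.sum_comm]
    rw [Nat.factorial_succ]
    push_cast
    rw [mul_comm ((r : ℝ) + 1), mul_assoc]
    congr 1
    rw [Finset.mul_sum]
    refine Finset.sum_congr rfl fun F _ => ?_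
    rw [Finset.sum_ite_mem, Finset.univ_inter, Finset.sum_const, nsmul_eq_mul]
    simp only [hG]
    split_ifs with hc
    · rw [hc.1]; push_cast; ring
    · simp

/-- The full sum of all partial contractions. -/
def Q (P : DF n) (A B : Finset (Fin n)) : ℝ :=
  ∑ E : Finset (Fin n), if Disjoint E (A ∪ B) then
      shuffleSign E A * shuffleSign E B * P (A ∪ E) (B ∪ E) else 0

lemma contrN_eq_Q (P : DF n) (p r : ℕ) (hP : IsDeg p P) (A B : Finset (Fin n))
    (h : A.card + r = p) : contrN r P A B = (r.factorial : ℝ) * Q P A B := by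
  rw [contrN_eq]
  congr 1
  unfold Q
  refine Finset.sum_congr rfl fun E _ => ?_
  by_cases hd : Disjoint E (A ∪ B)
  · rw [if_pos hd]
    rw [Finset.disjoint_union_right] at hd
    by_cases hc : E.card = r
    · rw [if_pos ⟨hc, hd⟩]
    · rw [if_neg (fun h => hc h.1)]
      have : P (A ∪ E) (B ∪ E) = 0 := by
        by_contra hne
        have := (hP _ _ hne).1
        rw [Finset.card_union_of_disjoint hd.1.symm] at this
        omega
      rw [this, mul_zero]
  · rw [if_neg hd, if_neg]
    rw [Finset.disjoint_union_right] at hd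
    exact fun h => hd h.2

lemma Q_symm (P : DF n) (hP : IsSymm P) (A B : Finset (Fin n)) : Q P A B = Q P B A := by
  unfold Q
  refine Finset.sum_congr rfl fun E _ => ?_
  rw [Finset.union_comm A B, hP (A ∪ E)]
  split_ifs <;> ring

lemma Q_empty (P : DF n) : Q P ∅ ∅ = ∑ E : Finset (Fin n), P E E := by
  simp [Q]

/-- Coefficient of `θ B D` in the trace of the product. -/
def W (P : DF n) (B D : Finset (Fin n)) : ℝ :=
  ∑ E : Finset (Fin n), if Disjoint E (B ∪ D) then
    shuffleSign ((D \ B) ∪ E) B * shuffleSign ((B \ D) ∪ E) D *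
      P ((D \ B) ∪ E) ((B \ D) ∪ E) else 0

lemma sum_superset (U : Finset (Fin n)) (F : Finset (Fin n) → ℝ) :
    ∑ S : Finset (Fin n), (if U ⊆ S then F S else 0) =
      ∑ E : Finset (Fin n), if Disjoint E U then F (U ∪ E) else 0 := by
  rw [← Finset.sum_filter, ← Finset.sum_filter]
  refine Finset.sum_bij' (fun S _ => S \ U) (fun E _ => U ∪ E) ?_ ?_ ?_ ?_ ?_
  · intro S _; simp [Finset.sdiff_disjoint]
  · intro E _; simp
  · intro S hS; simp at hS; exact Finset.union_sdiff_of_subset hS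
  · intro E hE; simp at hE
    rw [Finset.union_sdiff_left, Finset.sdiff_eq_self_of_disjoint hE]
  · intro S hS; simp at hS
    simp only [Finset.union_sdiff_of_subset hS]

lemma sum_powerset_compl (S : Finset (Fin n)) (F : Finset (Fin n) → Finset (Fin n) → ℝ) :
    ∑ A ∈ S.powerset, F A (S \ A) =
      ∑ B : Finset (Fin n), if B ⊆ S then F (S \ B) B else 0 := by
  rw [← Finset.sum_filter]
  refine Finset.sum_bij' (fun A _ => S \ A) (fun A _ => S \ A) ?_ ?_ ?_ ?_ ?_
  · intro A _; simp
  · intro A _; simp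
  · intro A hA; simp at hA; simp [hA]
  · intro A hA; simp at hA; simp [hA]
  · intro A hA; simp at hA; simp [hA]

lemma trace_mul (P θ : DF n) : ∑ S : Finset (Fin n), mul P θ S S =
    ∑ B : Finset (Fin n), ∑ D : Finset (Fin n), W P B D * θ B D := by
  have h1 : ∀ S : Finset (Fin n), mul P θ S S =
      ∑ B : Finset (Fin n), ∑ D : Finset (Fin n), if B ∪ D ⊆ S then
        shuffleSign (S \ B) B * shuffleSign (S \ D) D * P (S \ B) (S \ D) * θ B D else 0 := by
    intro S
    unfold mul
    rw [sum_powerset_compl S (fun A B => ∑ C ∈ S.powerset,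
      shuffleSign A B * shuffleSign C (S \ C) * P A C * θ B (S \ C))]
    refine Finset.sum_congr rfl fun B _ => ?_
    rw [sum_powerset_compl S (fun C D =>
      shuffleSign (S \ B) B * shuffleSign C D * P (S \ B) C * θ B D)]
    by_cases hB : B ⊆ S
    · simp [hB, Finset.union_subset_iff]
    · simp [hB, Finset.union_subset_iff]
  simp only [h1]
  rw [Finset.sum_comm]
  refine Finset.sum_congr rfl fun B _ => ?_
  rw [Finset.sum_comm]
  refine Finset.sum_congr rfl fun D _ => ?_
  rw [sum_superset (B ∪ D) (fun S =>
    shuffleSign (S \ B) B * shuffleSign (S \ D) D * P (S \ B) (S \ D) * θ B D)]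
  unfold W
  rw [Finset.sum_mul]
  refine Finset.sum_congr rfl fun E _ => ?_
  split_ifs with hd
  · rw [Finset.disjoint_union_right] at hd
    have e1 : (B ∪ D ∪ E) \ B = (D \ B) ∪ E := by
      rw [Finset.union_sdiff_distrib, Finset.union_sdiff_left,
        Finset.sdiff_eq_self_of_disjoint hd.1]
    have e2 : (B ∪ D ∪ E) \ D = (B \ D) ∪ E := by
      rw [Finset.union_sdiff_distrib, Finset.union_sdiff_right,
        Finset.sdiff_eq_self_of_disjoint hd.2]
    rw [e1, e2]
  · simp

/-- The Ricci-type pairing. -/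
lemma dinner_contr (X θ : DF n) : dinner X (contr θ) =
    ∑ B : Finset (Fin n), ∑ D : Finset (Fin n), (∑ l ∈ B ∩ D,
      shuffleSign {l} (B.erase l) * shuffleSign {l} (D.erase l) * X (B.erase l) (D.erase l)) *
      θ B D := by
  have hr : ∀ B D : Finset (Fin n), (∑ l ∈ B ∩ D,
      shuffleSign {l} (B.erase l) * shuffleSign {l} (D.erase l) * X (B.erase l) (D.erase l)) *
      θ B D = ∑ l : Fin n, if l ∈ B then (if l ∈ D then shuffleSign {l} (B.erase l) *
        shuffleSign {l} (D.erase l) * X (B.erase l) (D.erase l) * θ B D else 0) else 0 := by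
    intro B D
    rw [Finset.sum_mul, ← Finset.sum_filter, ← Finset.sum_filter]
    refine Finset.sum_congr ?_ fun _ _ => rfl
    ext l; simp
  simp only [hr]
  have e1 : ∀ f : Finset (Fin n) → Finset (Fin n) → Fin n → ℝ,
      ∑ B, ∑ D, ∑ l, f B D l = ∑ l, ∑ B, ∑ D, f B D l := by
    intro f
    rw [Finset.sum_congr rfl fun B _ => Finset.sum_comm, Finset.sum_comm]
  rw [e1]
  unfold dinner contr
  simp only [Finset.mul_sum]
  rw [e1]
  refine Finset.sum_congr rfl fun l _ => ?_
  have e2 : ∀ B : Finset (Fin n), ∑ D, (if l ∈ B then (if l ∈ D then shuffleSign {l} (B.erase l) *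
        shuffleSign {l} (D.erase l) * X (B.erase l) (D.erase l) * θ B D else 0) else 0) =
      if l ∈ B then ∑ D, (if l ∈ D then shuffleSign {l} (B.erase l) *
        shuffleSign {l} (D.erase l) * X (B.erase l) (D.erase l) * θ B D else 0) else 0 := by
    intro B; split_ifs <;> simp
  simp only [e2]
  rw [← sum_insert_reindex l (fun B => ∑ D, (if l ∈ D then shuffleSign {l} (B.erase l) *
        shuffleSign {l} (D.erase l) * X (B.erase l) (D.erase l) * θ B D else 0))]
  refine Finset.sum_congr rfl fun S _ => ?_
  by_cases hS : l ∈ S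
  · simp [hS]
  · rw [if_neg hS, ← sum_insert_reindex l (fun D => shuffleSign {l} ((insert l S).erase l) *
        shuffleSign {l} (D.erase l) * X ((insert l S).erase l) (D.erase l) * θ (insert l S) D)]
    refine Finset.sum_congr rfl fun T _ => ?_
    by_cases hT : l ∈ T
    · simp [hT]
    · simp only [hS, hT, or_self, if_false, Finset.erase_insert hS, Finset.erase_insert hT]
      ring

lemma pair_disjoint (P : DF n) (B D : Finset (Fin n)) (hB : B.card = 2) (hD : D.card = 2)
    (h : Disjoint B D) : W P B D = Q P D B := by
  have hs : shuffleSign D B * shuffleSign B D = 1 := by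
    obtain ⟨a, b, hab, rfl⟩ := Finset.card_eq_two.1 hB
    obtain ⟨c, d, hcd, rfl⟩ := Finset.card_eq_two.1 hD
    simp only [Finset.disjoint_insert_left, Finset.disjoint_singleton_left, Finset.mem_insert,
      Finset.mem_singleton, not_or] at h
    obtain ⟨⟨h1, h2⟩, h3, h4⟩ := h
    rw [sgn_insert_left c {d} _ (by simpa using hcd), sgn_insert_left a {b} _ (by simpa using hab)]
    rw [sgn_insert_right a {c} {b} (by simpa using hab),
      sgn_insert_right a {d} {b} (by simpa using hab),
      sgn_insert_right c {a} {d} (by simpa using hcd),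
      sgn_insert_right c {b} {d} (by simpa using hcd)]
    rw [sgn_swap a c h1, sgn_swap a d h2, sgn_swap b c h3, sgn_swap b d h4]
    have e1 := sgn_mul_self {c} {a}
    have e2 := sgn_mul_self {c} {b}
    have e3 := sgn_mul_self {d} {a}
    have e4 := sgn_mul_self {d} {b}
    calc _ = (shuffleSign {c} {a} * shuffleSign {c} {a}) * (shuffleSign {c} {b} *
          shuffleSign {c} {b}) * (shuffleSign {d} {a} * shuffleSign {d} {a}) *
          (shuffleSign {d} {b} * shuffleSign {d} {b}) := by ring
      _ = 1 := by rw [e1, e2, e3, e4]; norm_num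
  unfold W Q
  rw [Finset.sdiff_eq_self_of_disjoint h, Finset.sdiff_eq_self_of_disjoint h.symm,
    Finset.union_comm D B]
  refine Finset.sum_congr rfl fun E _ => ?_
  split_ifs with hd
  · rw [Finset.disjoint_union_right] at hd
    rw [sgn_union_left _ _ _ hd.1.symm, sgn_union_left _ _ _ hd.2.symm]
    linear_combination (shuffleSign E B * shuffleSign E D * P (D ∪ E) (B ∪ E)) * hs
  · rfl

lemma pair_one (P : DF n) (i j l : Fin n) (hij : i ≠ j) (hil : i ≠ l) (hjl : j ≠ l) :
    W P {i, l} {j, l} = Q P {j, l} {i, l} -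
      shuffleSign {l} {i} * shuffleSign {l} {j} * Q P {j} {i} := by
  have hd1 : ({j, l} : Finset (Fin n)) \ {i, l} = {j} := by
    ext x; simp; grind
  have hd2 : ({i, l} : Finset (Fin n)) \ {j, l} = {i} := by
    ext x; simp; grind
  have hu1 : ({i, l} : Finset (Fin n)) ∪ {j, l} = insert l {j, i} := by
    ext x; simp; grind
  have hu2 : ({j, l} : Finset (Fin n)) ∪ {i, l} = insert l {j, i} := by
    ext x; simp; grind
  have hu3 : ({j} : Finset (Fin n)) ∪ {i} = {j, i} := rfl
  unfold W Q
  rw [hd1, hd2, hu1, hu2, hu3]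
  rw [sum_disjoint_split l {j, i} (by simp; grind)
    (fun E => shuffleSign E {j} * shuffleSign E {i} * P ({j} ∪ E) ({i} ∪ E))]
  rw [Finset.mul_sum, ← Finset.sum_sub_distrib]
  refine Finset.sum_congr rfl fun E _ => ?_
  split_ifs with hd
  · simp only [Finset.disjoint_insert_right, Finset.disjoint_singleton_right] at hd
    obtain ⟨hl, hj, hi⟩ := hd
    have hjE : Disjoint {j} E := by simpa using hj
    have hiE : Disjoint {i} E := by simpa using hi
    rw [sgn_union_left _ _ _ hjE, sgn_union_left _ _ _ hiE]
    rw [sgn_insert_right i {j} {l} (by simpa using hil), sgn_insert_right i E {l} (by simpa using hil),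
      sgn_insert_right j {i} {l} (by simpa using hjl), sgn_insert_right j E {l} (by simpa using hjl),
      sgn_insert_left l E {j} hl, sgn_insert_left l E {i} hl]
    have hp1 : ({j, l} : Finset (Fin n)) ∪ E = {j} ∪ insert l E := by ext x; simp; tauto
    have hp2 : ({i, l} : Finset (Fin n)) ∪ E = {i} ∪ insert l E := by ext x; simp; tauto
    rw [hp1, hp2, sgn_swap j i hij.symm, sgn_swap j l hjl, sgn_swap i l hil]
    have e1 := sgn_mul_self {i} {j}
    have e2 := sgn_mul_self {l} {i}
    have e3 := sgn_mul_self {l} {j}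
    have e4 := sgn_mul_self E {l}
    generalize P ({j} ∪ insert l E) ({i} ∪ insert l E) = p1
    generalize P ({j} ∪ E) ({i} ∪ E) = p2
    generalize shuffleSign {i} {j} = a at *
    generalize shuffleSign {l} {i} = b at *
    generalize shuffleSign {l} {j} = c at *
    generalize shuffleSign E {l} = d at *
    generalize shuffleSign E {i} = x
    generalize shuffleSign E {j} = y
    grind
  · ring

lemma pair_same (P : DF n) (i l : Fin n) (hil : i ≠ l) :
    W P {i, l} {i, l} = Q P {i, l} {i, l} - Q P {i} {i} - Q P {l} {l} + Q P ∅ ∅ := by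
  unfold W Q
  simp only [sgn_mul_self, Finset.union_self, Finset.sdiff_self, one_mul, sgn_empty_right,
    Finset.empty_union]
  rw [sum_disjoint_split l {i} (by simpa using hil.symm) (fun E => P ({i} ∪ E) ({i} ∪ E)),
    sum_disjoint_split i {l} (by simpa using hil) (fun E => P ({l} ∪ E) ({l} ∪ E)),
    sum_disjoint_split i ∅ (by simp) (fun E => P E E),
    sum_disjoint_split l (insert i ∅) (by simpa using hil.symm) (fun E => P E E +
      P (insert i E) (insert i E))]
  have h1 : insert l (insert i (∅ : Finset (Fin n))) = {i, l} := by ext x; simp; tauto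
  have h2 : insert l ({i} : Finset (Fin n)) = {i, l} := by ext x; simp; tauto
  rw [h1, h2, ← Finset.sum_sub_distrib, ← Finset.sum_sub_distrib, ← Finset.sum_add_distrib]
  refine Finset.sum_congr rfl fun E _ => ?_
  have h3 : ({i, l} : Finset (Fin n)) ∪ E = insert i (insert l E) := by ext x; simp
  have h4 : ({i} : Finset (Fin n)) ∪ insert l E = insert i (insert l E) := by ext x; simp; tauto
  have h5 : ({l} : Finset (Fin n)) ∪ insert i E = insert i (insert l E) := by ext x; simp
  rw [h3, h4, h5, ← Finset.insert_eq, ← Finset.insert_eq]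
  split_ifs <;> ring

lemma pair_all (P : DF n) (hP : IsSymm P) (B D : Finset (Fin n)) (hB : B.card = 2)
    (hD : D.card = 2) : W P B D = Q P B D - (∑ l ∈ B ∩ D, shuffleSign {l} (B.erase l) *
      shuffleSign {l} (D.erase l) * Q P (B.erase l) (D.erase l)) +
      (if B = D then Q P ∅ ∅ else 0) := by
  by_cases hBD : B = D
  · subst hBD
    obtain ⟨i, l, hil, rfl⟩ := Finset.card_eq_two.1 hB
    have e1 : ({i, l} : Finset (Fin n)).erase i = {l} := by ext x; simp; grind
    have e2 : ({i, l} : Finset (Fin n)).erase l = {i} := by ext x; simp; grind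
    rw [pair_same P i l hil, Finset.inter_self, Finset.sum_pair hil, e1, e2, sgn_mul_self,
      sgn_mul_self, if_pos rfl]
    ring
  · rw [if_neg hBD]
    by_cases hd : Disjoint B D
    · rw [pair_disjoint P B D hB hD hd, Finset.disjoint_iff_inter_eq_empty.1 hd, Q_symm P hP D B]
      simp
    · obtain ⟨l, hlB, hlD⟩ := Finset.not_disjoint_iff.1 hd
      have hcB : (B.erase l).card = 1 := by rw [Finset.card_erase_of_mem hlB, hB]
      have hcD : (D.erase l).card = 1 := by rw [Finset.card_erase_of_mem hlD, hD]
      obtain ⟨i, hi⟩ := Finset.card_eq_one.1 hcB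
      obtain ⟨j, hj⟩ := Finset.card_eq_one.1 hcD
      have hil : i ≠ l := by
        have : i ∈ B.erase l := by simp [hi]
        exact Finset.ne_of_mem_erase this
      have hjl : j ≠ l := by
        have : j ∈ D.erase l := by simp [hj]
        exact Finset.ne_of_mem_erase this
      have hB' : B = {i, l} := by
        rw [← Finset.insert_erase hlB, hi, Finset.pair_comm]
      have hD' : D = {j, l} := by
        rw [← Finset.insert_erase hlD, hj, Finset.pair_comm]
      have hij : i ≠ j := by
        rintro rfl; exact hBD (hB'.trans hD'.symm)
      have hint : B ∩ D = {l} := by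
        rw [hB', hD']; ext x; simp; grind
      rw [hint, Finset.sum_singleton, hi, hj, hB', hD', pair_one P i j l hij hil hjl,
        Q_symm P hP {j, l}, Q_symm P hP {j}]
      ring

lemma mul_isSymm (ω θ : DF n) (h1 : IsSymm ω) (h2 : IsSymm θ) : IsSymm (mul ω θ) := by
  intro S T
  unfold mul
  rw [Finset.sum_comm]
  refine Finset.sum_congr rfl fun C _ => Finset.sum_congr rfl fun A _ => ?_
  rw [h1 A C, h2 (S \ A)]
  ring

lemma pow_isSymm (ω : DF n) (h : IsSymm ω) (k : ℕ) : IsSymm (pow ω k) := by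
  induction k with
  | zero => intro S T; simp [pow, one, and_comm]
  | succ k ih => exact mul_isSymm _ _ ih h

lemma mul_isDeg (ω θ : DF n) (p q : ℕ) (h1 : IsDeg p ω) (h2 : IsDeg q θ) :
    IsDeg (p + q) (mul ω θ) := by
  intro S T hne
  unfold mul at hne
  obtain ⟨A, hA, hne⟩ := Finset.exists_ne_zero_of_sum_ne_zero hne
  obtain ⟨C, hC, hne⟩ := Finset.exists_ne_zero_of_sum_ne_zero hne
  rw [Finset.mem_powerset] at hA hC
  have ha := h1 A C (by intro h; simp [h] at hne)
  have hb := h2 (S \ A) (T \ C) (by intro h; simp [h] at hne)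
  have := Finset.card_sdiff_add_card_eq_card hA
  have := Finset.card_sdiff_add_card_eq_card hC
  omega

lemma pow_isDeg (ω : DF n) (h : IsDeg 2 ω) (k : ℕ) : IsDeg (2 * k) (pow ω k) := by
  induction k with
  | zero =>
    intro S T hne
    simp [pow, one] at hne
    simp [hne.1, hne.2]
  | succ k ih => exact mul_isDeg _ _ _ _ ih h

lemma contr_isDeg (ω : DF n) (p : ℕ) (h : IsDeg (p + 1) ω) : IsDeg p (contr ω) := by
  intro S T hne
  unfold contr at hne
  obtain ⟨i, _, hne⟩ := Finset.exists_ne_zero_of_sum_ne_zero hne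
  split_ifs at hne with hi
  · exact absurd rfl hne
  · push Not at hi
    have := h (insert i S) (insert i T) (by intro h; simp [h] at hne)
    rw [Finset.card_insert_of_notMem hi.1, Finset.card_insert_of_notMem hi.2] at this
    omega

/-- The trace form of the formula. -/
lemma trace_formula (P θ : DF n) (hP : IsSymm P) (hθ : IsDeg 2 θ) :
    Q (mul P θ) ∅ ∅ = dinner (Q P) θ - dinner (Q P) (contr θ) + Q P ∅ ∅ * Q θ ∅ ∅ := by
  rw [Q_empty (mul P θ), trace_mul, dinner_contr, Q_empty θ, Finset.mul_sum]
  unfold dinner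
  rw [← Finset.sum_sub_distrib, ← Finset.sum_add_distrib]
  refine Finset.sum_congr rfl fun B _ => ?_
  have : Q P ∅ ∅ * θ B B = ∑ D : Finset (Fin n), (if B = D then Q P ∅ ∅ else 0) * θ B D := by
    simp
  rw [this, ← Finset.sum_sub_distrib, ← Finset.sum_add_distrib]
  refine Finset.sum_congr rfl fun D _ => ?_
  by_cases h : θ B D = 0
  · simp [h]
  · obtain ⟨h1, h2⟩ := hθ B D h
    rw [pair_all P hP B D h1 h2]
    ring

lemma dinner_contrN (P θ : DF n) (p q r : ℕ) (hP : IsDeg p P) (hθ : IsDeg q θ) (h : q + r = p) :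
    dinner (((r.factorial : ℕ) : ℝ)⁻¹ • contrN r P) θ = dinner (Q P) θ := by
  unfold dinner
  refine Finset.sum_congr rfl fun B _ => Finset.sum_congr rfl fun D _ => ?_
  by_cases h0 : θ B D = 0
  · simp [h0]
  · have hc := (hθ B D h0).1
    simp only [Pi.smul_apply, smul_eq_mul]
    rw [contrN_eq_Q P p r hP B D (by omega), inv_mul_cancel_left₀]
    exact_mod_cast r.factorial_ne_zero

lemma scalar_contrN (P : DF n) (r : ℕ) (hP : IsDeg r P) :
    toScalar (contrN r P) / (r.factorial : ℝ) = Q P ∅ ∅ := by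
  unfold toScalar
  rw [contrN_eq_Q P r r hP ∅ ∅ (by simp), mul_div_cancel_left₀]
  exact_mod_cast r.factorial_ne_zero

lemma ofCurv_isDeg {V : Type*} [NormedAddCommGroup V] [InnerProductSpace ℝ V]
    (e : OrthonormalBasis (Fin n) ℝ V) (R : V → V → V → V → ℝ) : IsDeg 2 (ofCurv e R) := by
  intro S T hne
  unfold ofCurv ofForm at hne
  by_contra h
  exact hne (dif_neg h)

lemma ofCurv_isSymm {V : Type*} [NormedAddCommGroup V] [InnerProductSpace ℝ V]
    (e : OrthonormalBasis (Fin n) ℝ V) (R : V → V → V → V → ℝ) (hR : IsCurv R) :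
    IsSymm (ofCurv e R) := by
  intro S T
  unfold ofCurv ofForm
  by_cases h : S.card = 2 ∧ T.card = 2
  · rw [dif_pos h, dif_pos h.symm]
    exact hR.pair_symm _ _ _ _
  · rw [dif_neg h, dif_neg (fun h' => h h'.symm)]

end Avez

/-- **Avez-type formula for higher Gauss–Bonnet curvatures.**
For an algebraic curvature tensor `R` and `k ≥ 1` with `2k+2 ≤ n`,
`h_{2k+2} = ⟨c^{2k−2}R^k/(2k−2)!, R⟩ − ⟨c^{2k−1}R^k/(2k−1)!, cR⟩ + h_{2k}·h₂`. -/
theorem stmt4_avez_type_formula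
    (n k : ℕ) (hk : 1 ≤ k) (hkn : 2 * k + 2 ≤ n)
    (V : Type*) [NormedAddCommGroup V] [InnerProductSpace ℝ V]
    (hV : Module.finrank ℝ V = n)
    (e : OrthonormalBasis (Fin n) ℝ V)
    (R : V → V → V → V → ℝ) (hR : IsCurv R) :
    h2kDF (k + 1) (ofCurv e R) =
      DF.dinner ((((2 * k - 2).factorial : ℕ) : ℝ)⁻¹ •
          DF.contrN (2 * k - 2) (DF.pow (ofCurv e R) k)) (ofCurv e R)
      - DF.dinner ((((2 * k - 1).factorial : ℕ) : ℝ)⁻¹ •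
          DF.contrN (2 * k - 1) (DF.pow (ofCurv e R) k)) (DF.contrN 1 (ofCurv e R))
      + h2kDF k (ofCurv e R) * (scalDF (ofCurv e R) / 2) := by
  have hd := Avez.ofCurv_isDeg e R
  have hs := Avez.ofCurv_isSymm e R hR
  generalize ofCurv e R = ρ at hd hs
  have hPd := Avez.pow_isDeg ρ hd k
  have hPs := Avez.pow_isSymm ρ hs k
  have hc : DF.IsDeg 1 (DF.contrN 1 ρ) := Avez.contr_isDeg ρ 1 hd
  rw [Avez.dinner_contrN _ ρ (2 * k) 2 (2 * k - 2) hPd hd (by omega),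
    Avez.dinner_contrN _ (DF.contrN 1 ρ) (2 * k) 1 (2 * k - 1) hPd hc (by omega)]
  unfold h2kDF scalDF
  rw [Avez.scalar_contrN _ _ hPd, Avez.scalar_contrN _ _ (Avez.pow_isDeg ρ hd (k + 1))]
  have h2 := Avez.scalar_contrN ρ 2 hd
  rw [Nat.factorial_two, Nat.cast_ofNat] at h2
  rw [h2]
  exact Avez.trace_formula (DF.pow ρ k) ρ hPs hd
end
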